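/- arXiv:1910.08843 — 2 statements merged into one kernel-verified Lean document; each statement's English description precedes it below -/
import Mathlib

section
/- For each integer n ≥ 9 with n ≠ 11 (equivalently, each n not in {3,4,5,6,7,8,11}), the alternating group A_n has a string C-group representation of rank ⌊(n−1)/2⌋. -/
/-- A string C-group representation of rank `n` of a group `G`: a family of `n`
involutions generating `G`, satisfying the commuting (string) property and the
intersection property. -/
def IsStringCGroupRep {G : Type*} [Group G] {n : ℕ} (ρ : Fin n → G) : Prop :=
  (∀ i, orderOf (ρ i) = 2) ∧
  Subgroup.closure (Set.range ρ) = ⊤ ∧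
  (∀ i j : Fin n, i.val + 1 < j.val → Commute (ρ i) (ρ j)) ∧
  (∀ I J : Set (Fin n),
    Subgroup.closure (ρ '' I) ⊓ Subgroup.closure (ρ '' J) = Subgroup.closure (ρ '' (I ∩ J)))

open Equiv Subgroup

section Intervals

variable {G : Type*} [Group G]

theorem exists_mul_of_mem_closure_union {A B : Set G} (h : ∀ a ∈ A, ∀ b ∈ B, Commute a b)
    {x : G} (hx : x ∈ closure (A ∪ B)) : ∃ y ∈ closure A, ∃ z ∈ closure B, x = y * z := by
  have hAB : ∀ y ∈ closure A, ∀ z ∈ closure B, z * y = y * z := by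
    have h1 : closure B ≤ centralizer A := by
      rw [closure_le]
      intro b hb a ha
      exact (h a ha b hb).eq
    have h2 : closure A ≤ centralizer (closure B) := by
      rw [closure_le]
      intro a ha b hb
      exact (h1 hb a ha).symm
    intro y hy z hz
    exact h2 hy z hz
  induction hx using closure_induction with
  | mem x hx =>
    rcases hx with hx | hx
    · exact ⟨x, subset_closure hx, 1, one_mem _, by simp⟩
    · exact ⟨1, one_mem _, x, subset_closure hx, by simp⟩
  | one => exact ⟨1, one_mem _, 1, one_mem _, by simp⟩
  | mul a b _ _ iha ihb =>
    obtain ⟨y, hy, z, hz, rfl⟩ := iha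
    obtain ⟨y', hy', z', hz', rfl⟩ := ihb
    refine ⟨y * y', mul_mem hy hy', z * z', mul_mem hz hz', ?_⟩
    have := hAB y' hy' z hz
    calc y * z * (y' * z') = y * (z * y') * z' := by group
      _ = y * y' * (z * z') := by rw [this]; group
  | inv a _ iha =>
    obtain ⟨y, hy, z, hz, rfl⟩ := iha
    refine ⟨y⁻¹, inv_mem hy, z⁻¹, inv_mem hz, ?_⟩
    rw [mul_inv_rev, hAB _ (inv_mem hy) _ (inv_mem hz)]

theorem iInf_closure_compl_le {r : ℕ} {ρ : Fin r → G}
    (hc : ∀ i j : Fin r, i.val + 1 < j.val → Commute (ρ i) (ρ j))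
    (hI : ∀ i j : Fin r, i < j →
      closure (ρ '' Set.Ioi i) ⊓ closure (ρ '' Set.Iio j) ≤ closure (ρ '' Set.Ioo i j))
    (O : Finset (Fin r)) (x : G) (hx : ∀ i ∈ O, x ∈ closure (ρ '' {i}ᶜ))
    (hx' : x ∈ closure (Set.range ρ)) : x ∈ closure (ρ '' (↑O : Set (Fin r))ᶜ) := by
  induction O using Finset.induction_on_max generalizing x with
  | empty => simpa using hx'
  | insert M O hM ih =>
    have hsplit : ∀ (q : Fin r) (y : G), y ∈ closure (ρ '' {q}ᶜ) →
        ∃ u ∈ closure (ρ '' Set.Iio q), ∃ v ∈ closure (ρ '' Set.Ioi q), y = u * v := by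
      intro q y hy
      apply exists_mul_of_mem_closure_union
      · rintro _ ⟨i, hi, rfl⟩ _ ⟨j, hj, rfl⟩
        apply hc
        simp only [Set.mem_Iio, Set.mem_Ioi, Fin.lt_def] at hi hj
        omega
      · rw [← Set.image_union, Set.Iio_union_Ioi]
        exact hy
    have hxM := hx M (by simp)
    by_cases hO : O.Nonempty
    · have hxO := ih x (fun i hi => hx i (by simp [hi])) hx'
      set p := O.max' hO with hp
      have hpO : p ∈ O := O.max'_mem hO
      have hpM : p < M := hM p hpO
      have h1 : (↑O : Set (Fin r))ᶜ = ((↑O : Set (Fin r))ᶜ ∩ Set.Iio p) ∪ Set.Ioi p := by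
        ext i
        simp only [Set.mem_compl_iff, Finset.mem_coe, Set.mem_union, Set.mem_inter_iff,
          Set.mem_Iio, Set.mem_Ioi]
        constructor
        · intro hi
          rcases lt_trichotomy i p with h | h | h
          · exact Or.inl ⟨hi, h⟩
          · exact absurd (h ▸ hpO) hi
          · exact Or.inr h
        · rintro (h | h)
          · exact h.1
          · intro hi
            exact absurd (O.le_max' i hi) (not_le.2 h)
      rw [h1, Set.image_union] at hxO
      obtain ⟨y, hy, z, hz, rfl⟩ := exists_mul_of_mem_closure_union (by
        rintro _ ⟨i, hi, rfl⟩ _ ⟨j, hj, rfl⟩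
        apply hc
        have := hi.2
        simp only [Set.mem_Iio, Set.mem_Ioi, Fin.lt_def] at this hj
        omega) hxO
      have hyM : y ∈ closure (ρ '' {M}ᶜ) := by
        refine closure_mono (Set.image_mono ?_) hy
        intro i hi
        have := hi.2
        simp only [Set.mem_Iio] at this
        exact (this.trans hpM).ne
      have hzM : z ∈ closure (ρ '' {M}ᶜ) := by
        have := mul_mem (inv_mem hyM) hxM
        simpa using this
      obtain ⟨u, hu, v, hv, rfl⟩ := hsplit M z hzM
      have hv' : v ∈ closure (ρ '' Set.Ioi p) :=
        closure_mono (Set.image_mono (Set.Ioi_subset_Ioi hpM.le)) hv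
      have hu' : u ∈ closure (ρ '' Set.Ioi p) := by
        have := mul_mem hz (inv_mem hv')
        simpa using this
      have hu2 := hI p M hpM ⟨hu', hu⟩
      have hsub : ∀ s : Set (Fin r), (∀ i ∈ s, i ∉ O ∧ i ≠ M) →
          closure (ρ '' s) ≤ closure (ρ '' (↑(insert M O) : Set (Fin r))ᶜ) := by
        intro s hs
        refine closure_mono (Set.image_mono ?_)
        intro i hi
        have := hs i hi
        simp [this.1, this.2]
      refine mul_mem (hsub _ ?_ hy) (mul_mem (hsub _ ?_ hu2) (hsub _ ?_ hv))
      · rintro i ⟨h, h'⟩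
        exact ⟨h, ((Set.mem_Iio.1 h').trans hpM).ne⟩
      · rintro i ⟨h, h'⟩
        exact ⟨fun hi => absurd (O.le_max' i hi) (not_le.2 h), h'.ne⟩
      · intro i h
        exact ⟨fun hi => absurd (hM i hi) (not_lt.2 (le_of_lt h)), (ne_of_lt h).symm⟩
    · rw [Finset.not_nonempty_iff_eq_empty] at hO
      subst hO
      simpa using hxM

theorem intersection_of_intervals {r : ℕ} {ρ : Fin r → G}
    (hc : ∀ i j : Fin r, i.val + 1 < j.val → Commute (ρ i) (ρ j))
    (hI : ∀ i j : Fin r, i < j →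
      closure (ρ '' Set.Ioi i) ⊓ closure (ρ '' Set.Iio j) ≤ closure (ρ '' Set.Ioo i j))
    (I J : Set (Fin r)) :
    closure (ρ '' I) ⊓ closure (ρ '' J) = closure (ρ '' (I ∩ J)) := by
  classical
  apply le_antisymm
  · rintro x ⟨hxI, hxJ⟩
    have := iInf_closure_compl_le hc hI (Set.toFinset (I ∩ J)ᶜ) x ?_
      (closure_mono (Set.image_subset_range _ _) hxI)
    · simpa using this
    · intro i hi
      simp only [Set.mem_toFinset, Set.mem_compl_iff, Set.mem_inter_iff, not_and_or] at hi
      rcases hi with hi | hi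
      · refine closure_mono (Set.image_mono ?_) hxI
        intro k hk hki
        exact hi (hki ▸ hk)
      · refine closure_mono (Set.image_mono ?_) hxJ
        intro k hk hki
        exact hi (hki ▸ hk)
  · exact le_inf (closure_mono (Set.image_mono Set.inter_subset_left))
      (closure_mono (Set.image_mono Set.inter_subset_right))

theorem isStringCGroupRep_of_injective {H : Type*} [Group H] {r : ℕ} {ρ : Fin r → G}
    (f : G →* H) (hf : Function.Injective f)
    (h2 : ∀ i, orderOf (f (ρ i)) = 2)
    (hgen : f.range ≤ closure (Set.range (f ∘ ρ)))
    (hc : ∀ i j : Fin r, i.val + 1 < j.val → Commute (f (ρ i)) (f (ρ j)))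
    (hI : ∀ i j : Fin r, i < j → closure ((f ∘ ρ) '' Set.Ioi i) ⊓
      closure ((f ∘ ρ) '' Set.Iio j) ≤ closure ((f ∘ ρ) '' Set.Ioo i j)) :
    IsStringCGroupRep ρ := by
  have hmap : ∀ s, closure ((f ∘ ρ) '' s) = (closure (ρ '' s)).map f := by
    intro s
    rw [Set.image_comp, MonoidHom.map_closure]
  refine ⟨fun i => ?_, ?_, fun i j hij => ?_, fun I J => ?_⟩
  · rw [← orderOf_injective f hf, h2]
  · rw [← Set.image_univ, hmap, Set.image_univ] at hgen
    apply map_injective hf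
    rw [← MonoidHom.range_eq_map]
    exact le_antisymm (map_le_range _ _) hgen
  · apply hf
    simpa using (hc i j hij).eq
  · apply map_injective hf
    rw [map_inf _ _ _ hf, ← hmap, ← hmap, ← hmap]
    exact intersection_of_intervals hc hI I J

end Intervals

section Transport

variable {Ω : Type*}

theorem exists_viaEmbedding_eq {α : Type*} (φ : α ↪ Ω) (g : Perm Ω)
    (hg : ∀ x, x ∉ Set.range φ → g x = x) : ∃ σ : Perm α, σ.viaEmbedding φ = g := by
  have hp : ∀ x, g x ∈ Set.range φ ↔ x ∈ Set.range φ := by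
    intro x
    by_cases hx : x ∈ Set.range φ
    · refine ⟨fun _ => hx, fun _ => ?_⟩
      by_contra h
      exact h ((g.injective (hg _ h)).symm ▸ hx)
    · rw [hg x hx]
  classical
  refine ⟨(Equiv.ofInjective φ φ.injective).permCongr.symm (g.subtypePerm hp), ?_⟩
  ext x
  by_cases hx : x ∈ Set.range φ
  · obtain ⟨a, rfl⟩ := hx
    rw [Perm.viaEmbedding_apply]
    simp [Equiv.permCongr_apply, Equiv.permCongr_symm, Equiv.apply_ofInjective_symm]
  · rw [Perm.viaEmbedding_apply_of_notMem _ _ _ hx, hg x hx]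

theorem sign_viaEmbedding {α : Type*} [Fintype α] [DecidableEq α] [Fintype Ω] [DecidableEq Ω]
    (φ : α ↪ Ω) (g : Perm α) : Perm.sign (g.viaEmbedding φ) = Perm.sign g := by
  classical
  rw [Perm.viaEmbedding]
  convert Perm.sign_extendDomain g (Equiv.ofInjective φ φ.injective) <;> rfl

theorem exists_isStringCGroupRep_of_embedding [Fintype Ω] [DecidableEq Ω] {n r : ℕ}
    (φ : Fin n ↪ Ω) (ρ : Fin r → Perm Ω)
    (h2 : ∀ i, orderOf (ρ i) = 2) (hsign : ∀ i, Perm.sign (ρ i) = 1)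
    (hfix : ∀ i x, x ∉ Set.range φ → ρ i x = x)
    (hc : ∀ i j : Fin r, i.val + 1 < j.val → Commute (ρ i) (ρ j))
    (hgen : ∀ g : Perm Ω, Perm.sign g = 1 → (∀ x, x ∉ Set.range φ → g x = x) →
      g ∈ closure (Set.range ρ))
    (hI : ∀ i j : Fin r, i < j →
      closure (ρ '' Set.Ioi i) ⊓ closure (ρ '' Set.Iio j) ≤ closure (ρ '' Set.Ioo i j)) :
    ∃ ρ' : Fin r → alternatingGroup (Fin n), IsStringCGroupRep ρ' := by
  choose σ hσ using fun i => exists_viaEmbedding_eq φ (ρ i) (hfix i)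
  have hs : ∀ i, σ i ∈ alternatingGroup (Fin n) := by
    intro i
    rw [Perm.mem_alternatingGroup, ← hsign i, ← hσ i, sign_viaEmbedding]
  let f : alternatingGroup (Fin n) →* Perm Ω :=
    (Perm.viaEmbeddingHom φ).comp (alternatingGroup (Fin n)).subtype
  have hfσ : (f ∘ fun i => ⟨σ i, hs i⟩) = ρ := funext hσ
  have hf' : ∀ i, f ⟨σ i, hs i⟩ = ρ i := hσ
  refine ⟨fun i => ⟨σ i, hs i⟩, isStringCGroupRep_of_injective f ?_ ?_ ?_ ?_ ?_⟩
  · exact (Perm.viaEmbeddingHom_injective φ).comp Subtype.val_injective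
  · simpa only [hf'] using h2
  · rw [hfσ]
    rintro _ ⟨g, rfl⟩
    apply hgen
    · change Perm.sign (Perm.viaEmbedding _ _) = 1
      rw [sign_viaEmbedding]
      exact g.2
    · intro x hx
      exact Perm.viaEmbedding_apply_of_notMem _ _ _ hx
  · simpa only [hf'] using hc
  · rw [hfσ]
    exact hI

end Transport

section AltOn

variable {Ω : Type*} [DecidableEq Ω]

/-- The permutation `x ↦ y ↦ z ↦ x`. -/
def cyc (x y z : Ω) : Perm Ω := swap x y * swap y z

theorem conj_cyc (g : Perm Ω) (x y z : Ω) : g * cyc x y z * g⁻¹ = cyc (g x) (g y) (g z) := by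
  rw [cyc, cyc, swap_apply_apply, swap_apply_apply]
  group

theorem cyc_rotate {x y z : Ω} (hxy : x ≠ y) (hxz : x ≠ z) (hyz : y ≠ z) :
    cyc x y z = cyc y z x := by
  ext w
  simp only [cyc, Perm.mul_apply, swap_apply_def]
  split_ifs <;> simp_all

theorem cyc_inv {x y z : Ω} : (cyc x y z)⁻¹ = cyc z y x := by
  simp [cyc, swap_comm]

theorem cyc_apply_left {x y z : Ω} (hxy : x ≠ y) (hxz : x ≠ z) : cyc x y z x = y := by
  simp [cyc, swap_apply_of_ne_of_ne hxy hxz]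

theorem cyc_apply_mid {x y z : Ω} (hxz : x ≠ z) (hyz : y ≠ z) : cyc x y z y = z := by
  simp [cyc, swap_apply_of_ne_of_ne hxz.symm hyz.symm]

theorem cyc_apply_right {x y z : Ω} (hxy : x ≠ y) (hxz : x ≠ z) (hyz : y ≠ z) :
    cyc x y z z = x := by
  rw [cyc_rotate hxy hxz hyz, cyc_apply_mid hxy.symm hxz.symm]

theorem cyc_apply_of_ne {x y z w : Ω} (hx : w ≠ x) (hy : w ≠ y) (hz : w ≠ z) :
    cyc x y z w = w := by
  simp [cyc, swap_apply_of_ne_of_ne, *]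

/-- `H` contains all `3`-cycles on points of `S`. -/
def AltOn (H : Subgroup (Perm Ω)) (S : Set Ω) : Prop :=
  ∀ x ∈ S, ∀ y ∈ S, ∀ z ∈ S, x ≠ y → x ≠ z → y ≠ z → cyc x y z ∈ H

theorem AltOn.mono {H K : Subgroup (Perm Ω)} {S T : Set Ω} (h : AltOn H S) (hHK : H ≤ K)
    (hTS : T ⊆ S) : AltOn K T :=
  fun x hx y hy z hz hxy hxz hyz => hHK (h x (hTS hx) y (hTS hy) z (hTS hz) hxy hxz hyz)

theorem altOn_of_star {H : Subgroup (Perm Ω)} {S : Set Ω} {x : Ω}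
    (h : ∀ w ∈ S, ∀ v ∈ S, w ≠ x → v ≠ x → w ≠ v → cyc x w v ∈ H) : AltOn H S := by
  intro u hu w hw v hv huw huv hwv
  by_cases h1 : u = x
  · subst h1
    exact h w hw v hv huw.symm huv.symm hwv
  by_cases h2 : w = x
  · subst h2
    rw [cyc_rotate huw huv hwv]
    exact h v hv u hu hwv.symm huw huv.symm
  by_cases h3 : v = x
  · subst h3
    rw [← cyc_rotate huv.symm hwv.symm huw]
    exact h u hu w hw huv hwv huw
  have := mul_mem (mul_mem (h u hu w hw h1 h2 huw) (h u hu v hv h1 h3 huv))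
    (inv_mem (h u hu w hw h1 h2 huw))
  rwa [conj_cyc, cyc_apply_left (Ne.symm h1) (Ne.symm h2), cyc_apply_mid (Ne.symm h2) huw,
    cyc_apply_of_ne h3 huv.symm hwv.symm] at this

theorem altOn_of_pair {H : Subgroup (Perm Ω)} {S : Set Ω} {x y : Ω} (hxy : x ≠ y)
    (h : ∀ w ∈ S, w ≠ x → w ≠ y → cyc x y w ∈ H) : AltOn H S := by
  have hy2 : ∀ w ∈ S, ∀ v ∈ S, w ≠ x → w ≠ y → v ≠ x → v ≠ y → w ≠ v → cyc y w v ∈ H := by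
    intro w hw v hv h1 h2 h3 h4 h5
    have := mul_mem (mul_mem (h w hw h1 h2) (h v hv h3 h4)) (inv_mem (h w hw h1 h2))
    rwa [conj_cyc, cyc_apply_left hxy h1.symm, cyc_apply_mid h1.symm h2.symm,
      cyc_apply_of_ne h3 h4 h5.symm] at this
  apply altOn_of_star (x := x)
  intro w hw v hv h1 h3 h5
  by_cases h2 : w = y
  · subst h2
    exact h v hv h3 h5.symm
  by_cases h4 : v = y
  · subst h4
    rw [← inv_mem_iff, cyc_inv, cyc_rotate (Ne.symm h2) h3 h1, cyc_rotate h1 h2 hxy]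
    exact h w hw h1 h2
  have := mul_mem (mul_mem (h v hv h3 h4) (hy2 v hv w hw h3 h4 h1 h2 h5.symm))
    (inv_mem (h v hv h3 h4))
  rwa [conj_cyc, cyc_apply_mid h3.symm (Ne.symm h4), cyc_apply_right hxy h3.symm (Ne.symm h4),
    cyc_apply_of_ne h1 h2 h5, cyc_rotate h3 h5.symm h1.symm] at this

theorem altOn_insert {H : Subgroup (Perm Ω)} {S : Set Ω} (hS : AltOn H S) {x y w : Ω}
    (hx : x ∈ S) (hy : y ∈ S) (hxy : x ≠ y) (h : cyc x y w ∈ H) : AltOn H (insert w S) := by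
  apply altOn_of_pair hxy
  rintro v (rfl | hv) h1 h2
  · exact h
  · exact hS x hx y hy v hv hxy h1.symm h2.symm

theorem altOn_insert_map {H : Subgroup (Perm Ω)} {S : Set Ω} (hS : AltOn H S) {x y z : Ω}
    (hx : x ∈ S) (hy : y ∈ S) (hz : z ∈ S) (hxy : x ≠ y) (hxz : x ≠ z) (hyz : y ≠ z)
    {g : Perm Ω} (hg : g ∈ H) (hgx : g x ∈ S) (hgy : g y ∈ S) :
    AltOn H (insert (g z) S) := by
  refine altOn_insert hS hgx hgy (g.injective.ne hxy) ?_
  rw [← conj_cyc]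
  exact mul_mem (mul_mem hg (hS x hx y hy z hz hxy hxz hyz)) (inv_mem hg)

theorem AltOn.mem_of_even [Fintype Ω] {H : Subgroup (Perm Ω)} {S : Set Ω} (hS : AltOn H S)
    {g : Perm Ω} (hg : Perm.sign g = 1) (hgS : ∀ x, x ∉ S → g x = x) : g ∈ H := by
  classical
  have hp : ∀ x, g x ∈ S ↔ x ∈ S := by
    intro x
    by_cases hx : x ∈ S
    · refine ⟨fun _ => hx, fun _ => ?_⟩
      by_contra h
      exact h ((g.injective (hgS _ h)).symm ▸ hx)
    · rw [hgS x hx]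
  have h1 : Perm.ofSubtype (g.subtypePerm hp) = g :=
    Perm.ofSubtype_subtypePerm hp fun x hx => by
      by_contra h
      exact hx (hgS x h)
  have h2 : g.subtypePerm hp ∈ alternatingGroup S := by
    rw [Perm.mem_alternatingGroup, ← Perm.sign_ofSubtype, h1, hg]
  rw [← Perm.closure_three_cycles_eq_alternating] at h2
  have h3 := mem_map_of_mem Perm.ofSubtype h2
  rw [h1, MonoidHom.map_closure] at h3
  refine (closure_le _).2 ?_ h3
  rintro _ ⟨σ, hσ, rfl⟩
  obtain ⟨a, b, c, hab, hac, hbc, rfl⟩ : ∃ a b c : S, a ≠ b ∧ a ≠ c ∧ b ≠ c ∧ σ = cyc a b c := by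
    obtain ⟨a, ha⟩ := hσ.isCycle.nonempty_support
    have := (Perm.IsThreeCycle.nodup_iff_mem_support hσ).2 ha
    simp only [List.nodup_cons, List.mem_cons, List.not_mem_nil, or_false, not_or] at this
    exact ⟨a, σ a, σ (σ a), this.1.1, this.1.2, this.2.1,
      hσ.eq_swap_mul_swap_iff_mem_support.2 ha⟩
  simp only [cyc, map_mul, Perm.ofSubtype_swap_eq]
  exact hS a a.2 b b.2 c c.2 (Subtype.coe_injective.ne hab) (Subtype.coe_injective.ne hac)
    (Subtype.coe_injective.ne hbc)

end AltOn

section Schreier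

variable {α : Type*}

theorem mem_of_coset_representatives {ι : Type*} {S : Set (Perm α)} {H : Subgroup (Perm α)}
    {x : α} (r : ι → Perm α) {i₀ : ι} (h1 : r i₀ = 1) (hS : ∀ s ∈ S, s⁻¹ = s)
    (hr : ∀ s ∈ S, ∀ i, ∃ j, (r j)⁻¹ * (s * r i) ∈ H) (hH : ∀ h ∈ H, h x = x)
    (hx : ∀ i, r i x = x → i = i₀) {g : Perm α} (hg : g ∈ closure S) (hgx : g x = x) : g ∈ H := by
  have step : ∀ s ∈ S, ∀ g, (∃ i, (r i)⁻¹ * g ∈ H) → ∃ i, (r i)⁻¹ * (s * g) ∈ H := by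
    rintro s hs g ⟨i, hi⟩
    obtain ⟨j, hj⟩ := hr s hs i
    refine ⟨j, ?_⟩
    have := mul_mem hj hi
    convert this using 1
    group
  have key : ∃ i, (r i)⁻¹ * g ∈ H := by
    clear hgx
    induction hg using closure_induction_left with
    | one => exact ⟨i₀, by simp [h1, one_mem]⟩
    | mul_left s hs g _ ih => exact step s hs g ih
    | inv_mul_cancel s hs g _ ih =>
      rw [hS s hs]
      exact step s hs g ih
  obtain ⟨i, hi⟩ := key
  obtain rfl : i = i₀ := by
    apply hx
    have := hH _ hi
    rw [Perm.mul_apply, hgx] at this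
    nth_rw 1 [← this]
    simp
  simpa [h1] using hi

theorem mem_closure_singleton_of_mul_self {G : Type*} [Group G] {b g : G} (hb : b * b = 1)
    (hg : g ∈ closure {b}) : g = 1 ∨ g = b := by
  induction hg using closure_induction_left with
  | one => exact Or.inl rfl
  | mul_left x hx y hy ih =>
    obtain rfl : x = b := hx
    rcases ih with rfl | rfl
    · exact Or.inr (mul_one _)
    · exact Or.inl hb
  | inv_mul_cancel x hx y hy ih =>
    obtain rfl : x = b := hx
    rw [inv_eq_of_mul_eq_one_left hb]
    rcases ih with rfl | rfl
    · exact Or.inr (mul_one _)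
    · exact Or.inl hb

theorem fixed_of_mem_closure {S : Set (Perm α)} {x : α} (h : ∀ s ∈ S, s x = x) {g : Perm α}
    (hg : g ∈ closure S) : g x = x :=
  (closure_le (MulAction.stabilizer (Perm α) x)).2 h hg

theorem alternating_word_eq_of_mul_pow_five {G : Type*} [Group G] {a b : G} (hb : b * b = 1)
    (hab : (a * b) ^ 5 = 1) : a * (b * (a * (b * (a * (b * (a * (b * a))))))) = b := by
  have : a * (b * (a * (b * (a * (b * (a * (b * a))))))) * b = 1 := by
    rw [← hab]
    simp only [pow_succ, pow_zero, one_mul, mul_assoc]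
  rwa [mul_eq_one_iff_eq_inv, inv_eq_of_mul_eq_one_left hb] at this

variable {a b c : Perm α} {x : α}

theorem mem_closure_of_fixed_of_pow_five (ha : a * a = 1) (hb : b * b = 1) (hab : (a * b) ^ 5 = 1)
    (hbx : b x = x) (h1 : a x ≠ x) (h2 : b (a x) ≠ x) (h3 : a (b (a x)) ≠ x)
    (h4 : b (a (b (a x))) ≠ x) {g : Perm α} (hg : g ∈ closure {a, b}) (hgx : g x = x) :
    g ∈ closure {b} := by
  have ha' : a⁻¹ = a := inv_eq_of_mul_eq_one_left ha
  have hb' : b⁻¹ = b := inv_eq_of_mul_eq_one_left hb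
  have hbm : b ∈ closure {b} := subset_closure rfl
  have hr := alternating_word_eq_of_mul_pow_five hb hab
  refine mem_of_coset_representatives ![1, a, b * a, a * (b * a), b * (a * (b * a))] (i₀ := 0)
    rfl ?_ ?_ (fun h hh => fixed_of_mem_closure ?_ hh) ?_ hg hgx
  · rintro _ (rfl | rfl) <;> assumption
  · rintro _ (rfl | rfl) i <;> fin_cases i
    · exact ⟨1, by simp [one_mem]⟩
    · exact ⟨0, by simp [ha, one_mem]⟩
    · exact ⟨3, by simp [one_mem]⟩
    · exact ⟨2, by simp [← mul_assoc, ha, one_mem]⟩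
    · exact ⟨4, by simp [mul_assoc, ha', hb', hr]⟩
    · exact ⟨0, by simp⟩
    · exact ⟨2, by simp [one_mem]⟩
    · exact ⟨1, by simp [← mul_assoc, hb, one_mem]⟩
    · exact ⟨4, by simp [one_mem]⟩
    · exact ⟨3, by simp [← mul_assoc, hb, one_mem]⟩
  · rintro _ rfl
    exact hbx
  · intro i
    fin_cases i <;> simp [*]

theorem mem_closure_pair_of_fixed (ha : a * a = 1) (hb : b * b = 1) (hc : c * c = 1)
    (hac : a * c = c * a) (hab : (a * b) ^ 5 = 1)
    (h : a * b * a * c * b * a = b * c * b * c * b * c * b)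
    (h' : a * b * a * b * c * b * c * b * a * b * a = b * c * b * c * b)
    (hbx : b x = x) (hcx : c x = x) (h1 : a x ≠ x) (h2 : b (a x) ≠ x) (h3 : a (b (a x)) ≠ x)
    (h4 : b (a (b (a x))) ≠ x) (h5 : c (b (a (b (a x)))) ≠ x) {g : Perm α}
    (hg : g ∈ closure {a, b, c}) (hgx : g x = x) : g ∈ closure {b, c} := by
  have ha' : a⁻¹ = a := inv_eq_of_mul_eq_one_left ha
  have hb' : b⁻¹ = b := inv_eq_of_mul_eq_one_left hb
  have hc' : c⁻¹ = c := inv_eq_of_mul_eq_one_left hc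
  have hbm : b ∈ closure {b, c} := subset_closure (by simp)
  have hcm : c ∈ closure {b, c} := subset_closure (by simp)
  have hm : a * (b * (a * (c * (b * a)))) ∈ closure {b, c} := by
    have : a * (b * (a * (c * (b * a)))) = b * c * b * c * b * c * b := by rw [← h]; group
    rw [this]
    repeat' apply mul_mem
    all_goals assumption
  have hm' : a * (b * (a * (b * (c * (b * (c * (b * (a * (b * a))))))))) ∈ closure {b, c} := by
    have : a * (b * (a * (b * (c * (b * (c * (b * (a * (b * a))))))))) = b * c * b * c * b := by
      rw [← h']; group
    rw [this]
    repeat' apply mul_mem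
    all_goals assumption
  have hr := alternating_word_eq_of_mul_pow_five hb hab
  have hac' : ∀ y, c * (a * y) = a * (c * y) := fun y => by rw [← mul_assoc, ← hac, mul_assoc]
  have hca : c * a = a * c := hac.symm
  have haa : ∀ y, a * (a * y) = y := fun y => by rw [← mul_assoc, ha, one_mul]
  have hcc : ∀ y, c * (c * y) = y := fun y => by rw [← mul_assoc, hc, one_mul]
  refine mem_of_coset_representatives
    ![1, a, b * a, a * (b * a), b * (a * (b * a)), c * (b * (a * (b * a)))] (i₀ := 0)
    rfl ?_ ?_ (fun h hh => fixed_of_mem_closure ?_ hh) ?_ hg hgx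
  · rintro _ (rfl | rfl | rfl) <;> assumption
  · rintro _ (rfl | rfl | rfl) i <;> fin_cases i
    · exact ⟨1, by simp [one_mem]⟩
    · exact ⟨0, by simp [ha, one_mem]⟩
    · exact ⟨3, by simp [one_mem]⟩
    · exact ⟨2, by simp [← mul_assoc, ha, one_mem]⟩
    · exact ⟨4, by simpa [mul_assoc, ha', hb', hr] using hbm⟩
    · exact ⟨5, by simpa [mul_assoc, ha', hb', hc', hac', hcc, hr] using hbm⟩
    · exact ⟨0, by simpa using hbm⟩
    · exact ⟨2, by simp [one_mem]⟩
    · exact ⟨1, by simp [← mul_assoc, hb, one_mem]⟩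
    · exact ⟨4, by simp [one_mem]⟩
    · exact ⟨3, by simp [← mul_assoc, hb, one_mem]⟩
    · exact ⟨5, by simpa [mul_assoc, ha', hb', hc'] using hm'⟩
    · exact ⟨0, by simpa using hcm⟩
    · exact ⟨1, by simpa [ha', hca, haa] using hcm⟩
    · exact ⟨3, by simpa [mul_assoc, ha', hb'] using hm⟩
    · exact ⟨2, by simpa [mul_assoc, ha', hb', hac'] using hm⟩
    · exact ⟨5, by simp [one_mem]⟩
    · exact ⟨4, by simp [← mul_assoc, hc, one_mem]⟩
  · rintro _ (rfl | rfl) <;> assumption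
  · intro i
    fin_cases i <;> simp [*]

end Schreier

section Family

open Sum (inl inr)

variable {m : ℕ}

/-- Five special points together with `m` pairs of points. -/
abbrev Pts (m : ℕ) : Type := Fin 5 ⊕ Fin m × Bool

/-- The permutation fixing the special points, moving the pairs by `π` and exchanging the two
points of the `k`-th pair when `f k` holds. -/
def signed (π : Perm (Fin m)) (f : Fin m → Bool) : Perm (Pts m) :=
  Perm.sumCongr 1 ((prodCongrLeft fun _ => π) * prodCongrRight fun k => bif f k then boolNot else 1)

@[simp] theorem signed_inl (π : Perm (Fin m)) (f : Fin m → Bool) (c : Fin 5) :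
    signed π f (inl c) = inl c := rfl

@[simp] theorem signed_inr (π : Perm (Fin m)) (f : Fin m → Bool) (x : Fin m × Bool) :
    signed π f (inr x) = inr (π x.1, xor x.2 (f x.1)) := by
  obtain ⟨k, b⟩ := x
  simp only [signed, Perm.sumCongr_apply, Sum.map_inr, Perm.mul_apply, prodCongrRight_apply,
    prodCongrLeft_apply]
  cases f k <;> simp

theorem signed_mul (π π' : Perm (Fin m)) (f f' : Fin m → Bool) :
    signed π f * signed π' f' = signed (π * π') fun k => xor (f' k) (f (π' k)) := by
  ext x
  rcases x with c | x <;> simp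

theorem signed_one : signed (1 : Perm (Fin m)) (fun _ => false) = 1 := by
  ext x
  rcases x with c | x <;> simp

theorem signed_congr {π π' : Perm (Fin m)} {f f' : Fin m → Bool} (h : π = π')
    (h' : ∀ k, f k = f' k) : signed π f = signed π' f' := by
  rw [h, funext h']

theorem signed_injective {π π' : Perm (Fin m)} {f f' : Fin m → Bool}
    (h : signed π f = signed π' f') : π = π' ∧ f = f' := by
  have : ∀ l, π l = π' l ∧ f l = f' l := by
    intro l
    simpa using DFunLike.congr_fun h (inr (l, false))
  exact ⟨Equiv.ext fun l => (this l).1, funext fun l => (this l).2⟩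

theorem signed_one_mul (f f' : Fin m → Bool) :
    signed 1 f * signed 1 f' = signed 1 fun k => xor (f' k) (f k) :=
  signed_mul 1 1 f f'

theorem sign_signed (π : Perm (Fin m)) (f : Fin m → Bool) :
    Perm.sign (signed π f) = ∏ k, if f k then -1 else 1 := by
  rw [signed, Perm.sign_sumCongr, Perm.sign_mul, Perm.sign_prodCongrLeft, Perm.sign_prodCongrRight]
  have h : Perm.sign boolNot = -1 := by decide
  simp only [Perm.sign_one, one_mul, Fintype.prod_bool, Int.units_mul_self]
  refine Finset.prod_congr rfl fun k _ => ?_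
  cases f k <;> simp [h]

variable [NeZero m]

/-- The transposition of the pairs `k` and `k + 1`. -/
def tau (m k : ℕ) [NeZero m] : Perm (Fin m) := swap (Fin.ofNat m k) (Fin.ofNat m (k + 1))

theorem tau_val {k : ℕ} (hk : k + 1 < m) (l : Fin m) :
    (tau m k l).val = if l.val = k then k + 1 else if l.val = k + 1 then k else l.val := by
  have h1 : (Fin.ofNat m k).val = k := Nat.mod_eq_of_lt (by omega)
  have h2 : (Fin.ofNat m (k + 1)).val = k + 1 := Nat.mod_eq_of_lt hk
  rw [tau, swap_apply_def]
  simp only [Fin.ext_iff, h1, h2]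
  split_ifs <;> simp_all

theorem tau_mul_self (k : ℕ) : tau m k * tau m k = 1 := swap_mul_self _ _

/-- The generators: three permutations moving the special points, followed by exchanges of
neighbouring pairs, the one with index `s + 3` carrying an additional flip of all pairs from
`s + 2` onwards. -/
def gen (m s : ℕ) [NeZero m] : ℕ → Perm (Pts m)
  | 0 => swap (inl 0) (inl 1) * swap (inl 2) (inl 3)
  | 1 => swap (inl 1) (inl 2) * swap (inl 3) (inl 4)
  | 2 => swap (inl 2) (inl 3) * swap (inl 4) (inr (Fin.ofNat m 0, false))
  | k + 3 => signed (tau m k) fun l => decide (k = s ∧ s + 2 ≤ l.val)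

theorem commute_swap_of_fixed {α : Type*} [DecidableEq α] {g : Perm α} {x y : α} (hx : g x = x)
    (hy : g y = y) : Commute g (swap x y) := by
  have := swap_apply_apply g x y
  rw [hx, hy] at this
  rw [Commute, SemiconjBy]
  nth_rw 2 [this]
  group

variable {s : ℕ}

theorem gen_mul_self {k : ℕ} (hk : k < m + 2) : gen m s k * gen m s k = 1 := by
  have aux : ∀ a b c d : Pts m, a ≠ c → a ≠ d → b ≠ c → b ≠ d →
      (swap a b * swap c d) * (swap a b * swap c d) = 1 := by
    intro a b c d h1 h2 h3 h4
    have h := (commute_swap_of_fixed (g := swap a b) (x := c) (y := d)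
      (swap_apply_of_ne_of_ne h1.symm h3.symm) (swap_apply_of_ne_of_ne h2.symm h4.symm)).eq
    calc _ = swap a b * (swap c d * swap a b) * swap c d := by group
      _ = (swap a b * swap a b) * (swap c d * swap c d) := by rw [← h]; group
      _ = 1 := by simp
  match k with
  | 0 => apply aux <;> simp
  | 1 => apply aux <;> simp
  | 2 => apply aux <;> simp
  | k + 3 =>
    rw [gen, signed_mul, tau_mul_self, ← signed_one]
    apply signed_congr rfl
    intro l
    have := tau_val (m := m) (k := k) (by omega) l
    by_cases hks : k = s
    · subst hks
      rw [this]
      simp only [true_and]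
      split_ifs <;> grind
    · simp [hks]

theorem gen_ne_one {k : ℕ} (hk : k < m + 2) : gen m s k ≠ 1 := by
  match k with
  | 0 => exact fun h => by simpa [gen, swap_apply_of_ne_of_ne] using DFunLike.congr_fun h (inl 0)
  | 1 => exact fun h => by simpa [gen, swap_apply_of_ne_of_ne] using DFunLike.congr_fun h (inl 1)
  | 2 => exact fun h => by simpa [gen, swap_apply_of_ne_of_ne] using DFunLike.congr_fun h (inl 2)
  | k + 3 =>
    intro h
    have h1 := DFunLike.congr_fun h (inr (⟨k, by omega⟩, false))
    have h2 := tau_val (m := m) (k := k) (by omega) ⟨k, by omega⟩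
    simp only [gen, signed_inr, Perm.one_apply, Sum.inr.injEq, Prod.mk.injEq] at h1
    rw [h1.1] at h2
    simp at h2

theorem orderOf_gen {k : ℕ} (hk : k < m + 2) : orderOf (gen m s k) = 2 :=
  orderOf_eq_prime (by rw [sq, gen_mul_self hk]) (gen_ne_one hk)

theorem gen_commute {i j : ℕ} (hij : i + 1 < j) (hj : j < m + 2) :
    Commute (gen m s i) (gen m s j) := by
  match i, j with
  | 0, 2 =>
    refine Commute.mul_right (Commute.mul_left (commute_swap_of_fixed ?_ ?_) rfl)
      (commute_swap_of_fixed ?_ ?_) <;> simp [gen, swap_apply_of_ne_of_ne]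
  | 0, k + 3 =>
    apply Commute.symm
    apply Commute.mul_right <;> apply commute_swap_of_fixed <;> simp [gen]
  | 1, k + 3 =>
    apply Commute.symm
    apply Commute.mul_right <;> apply commute_swap_of_fixed <;> simp [gen]
  | 2, k + 3 =>
    apply Commute.symm
    have h1 : tau m k (Fin.ofNat m 0) = Fin.ofNat m 0 := by
      ext
      rw [tau_val (by omega)]
      simp
      omega
    rw [Fin.ofNat_zero] at h1
    apply Commute.mul_right <;> apply commute_swap_of_fixed <;> simp [gen, h1]
  | i + 3, k + 3 =>
    rw [Commute, SemiconjBy, gen, gen, signed_mul, signed_mul]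
    refine signed_congr ?_ fun l => ?_
    · ext l
      simp only [Perm.mul_apply]
      rw [tau_val (by omega), tau_val (by omega), tau_val (by omega), tau_val (by omega)]
      grind
    · rw [tau_val (by omega), tau_val (by omega)]
      grind

theorem sign_gen {k : ℕ} (hk : k < m + 2) (hs : s + 2 < m) (hm : Even (m - (s + 2))) :
    Perm.sign (gen m s k) = 1 := by
  match k with
  | 0 => simp [gen]
  | 1 => simp [gen]
  | 2 => simp [gen]
  | k + 3 =>
    rw [gen, sign_signed]
    by_cases hks : k = s
    · simp only [hks, true_and, decide_eq_true_eq]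
      rw [Finset.prod_ite, Finset.prod_const, Finset.prod_const_one, mul_one]
      have : (Finset.univ.filter fun l : Fin m => s + 2 ≤ l.val).card = m - (s + 2) := by
        have h := Fin.card_Ici (⟨s + 2, by omega⟩ : Fin m)
        rw [← h]
        congr 1
        ext l
        simp [Fin.le_def]
      rw [this, hm.neg_one_pow]
    · simp [hks]

end Family

section Groups

open Sum (inl inr)

variable {m s : ℕ} [NeZero m]

/-- The subgroup generated by the generators with index in `[lo, hi)`. -/
def gam (m s lo hi : ℕ) [NeZero m] : Subgroup (Perm (Pts m)) :=
  closure (gen m s '' Set.Ico lo hi)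

theorem gen_mem_gam {k lo hi : ℕ} (h1 : lo ≤ k) (h2 : k < hi) : gen m s k ∈ gam m s lo hi :=
  subset_closure ⟨k, ⟨h1, h2⟩, rfl⟩

theorem gam_mono {lo hi lo' hi' : ℕ} (h1 : lo' ≤ lo) (h2 : hi ≤ hi') :
    gam m s lo hi ≤ gam m s lo' hi' :=
  closure_mono (Set.image_mono (Set.Ico_subset_Ico h1 h2))

theorem gam_induction {lo hi : ℕ} (hhi : hi ≤ m + 2) {p : Perm (Pts m) → Prop} (one : p 1)
    (step : ∀ k, lo ≤ k → k < hi → ∀ g ∈ gam m s lo hi, p g → p (gen m s k * g))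
    {g : Perm (Pts m)} (hg : g ∈ gam m s lo hi) : p g := by
  induction hg using closure_induction_left with
  | one => exact one
  | mul_left x hx y hy ih =>
    obtain ⟨k, ⟨h1, h2⟩, rfl⟩ := hx
    exact step k h1 h2 y hy ih
  | inv_mul_cancel x hx y hy ih =>
    obtain ⟨k, ⟨h1, h2⟩, rfl⟩ := hx
    rw [inv_eq_of_mul_eq_one_left (gen_mul_self (s := s) (show k < m + 2 by omega))]
    exact step k h1 h2 y hy ih

theorem sign_of_mem_gam (hs : s + 2 < m) (hm : Even (m - (s + 2))) {lo hi : ℕ}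
    (hhi : hi ≤ m + 2) {g : Perm (Pts m)} (hg : g ∈ gam m s lo hi) : Perm.sign g = 1 := by
  refine gam_induction (p := fun g => Perm.sign g = 1) hhi (by simp) ?_ hg
  intro k h1 h2 g _ ih
  rw [Perm.sign_mul, ih, sign_gen (by omega) hs hm, mul_one]

/-- The points of the pairs on which the subgroup generated by the generators with index below
`N + 2` acts through the subgroup generated by those with index in `[3, N + 2)`. -/
def Tail (s N : ℕ) (x : Fin m × Bool) : Prop := N ≤ x.1.val ∨ (x.2 = true ∧ N ≤ s + 2)

theorem gen_apply_tail_of_le_two {k N : ℕ} (hk : k ≤ 2) (hN : 1 ≤ N) {x : Fin m × Bool}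
    (hx : Tail s N x) : gen m s k (inr x) = inr x := by
  interval_cases k
  · simp [gen, swap_apply_of_ne_of_ne]
  · simp [gen, swap_apply_of_ne_of_ne]
  · have : x ≠ (0, false) := by
      rintro rfl
      simp [Tail] at hx
      omega
    simp [gen, swap_apply_of_ne_of_ne, this]

theorem gam_apply_tail {N : ℕ} (hN : N ≤ m) {h : Perm (Pts m)} (hh : h ∈ gam m s 3 (N + 2))
    {x : Fin m × Bool} (hx : Tail s N x) : ∃ y, Tail s N y ∧ h (inr x) = inr y := by
  refine gam_induction (p := fun h => ∃ y, Tail s N y ∧ h (inr x) = inr y) (by omega)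
    ⟨x, hx, rfl⟩ ?_ hh
  rintro k h1 h2 g - ⟨y, hy, hgy⟩
  obtain ⟨k, rfl⟩ := Nat.exists_eq_add_of_le' h1
  have := tau_val (m := m) (k := k) (by omega) y.1
  refine ⟨_, ?_, by rw [Perm.mul_apply, hgy, gen, signed_inr]⟩
  rcases hy with hy | ⟨hy, hy'⟩
  · left
    simp only
    rw [this]
    split_ifs <;> omega
  · by_cases h3 : k = s ∧ s + 2 ≤ y.1.val
    · left
      simp only
      rw [this]
      split_ifs <;> omega
    · right
      simp only [hy, Bool.true_bne, Bool.not_eq_true', decide_eq_false_iff_not]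
      exact ⟨h3, hy'⟩

theorem exists_eq_on_tail {N : ℕ} (hN1 : 1 ≤ N) (hN : N ≤ m) {g : Perm (Pts m)}
    (hg : g ∈ gam m s 0 (N + 2)) :
    ∃ h ∈ gam m s 3 (N + 2), ∀ x, Tail s N x → g (inr x) = h (inr x) := by
  refine gam_induction (p := fun g => ∃ h ∈ gam m s 3 (N + 2), ∀ x, Tail s N x →
    g (inr x) = h (inr x)) (by omega) ⟨1, one_mem _, fun _ _ => rfl⟩ ?_ hg
  rintro k - h2 g - ⟨h, hh, hgh⟩
  by_cases hk : 3 ≤ k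
  · refine ⟨gen m s k * h, mul_mem (gen_mem_gam hk h2) hh, fun x hx => ?_⟩
    rw [Perm.mul_apply, Perm.mul_apply, hgh x hx]
  · refine ⟨h, hh, fun x hx => ?_⟩
    obtain ⟨y, hy, hxy⟩ := gam_apply_tail hN hh hx
    rw [Perm.mul_apply, hgh x hx, hxy, gen_apply_tail_of_le_two (by omega) hN1 hy]

theorem exists_signed_of_mem_gam {N : ℕ} (hN : N ≤ m) {g : Perm (Pts m)}
    (hg : g ∈ gam m s 3 (N + 2)) : ∃ π f, g = signed π f ∧ (∀ l, N ≤ l.val → π l = l) ∧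
      ∃ ε, s + 2 ≤ N → ∀ l, N ≤ l.val → f l = ε := by
  refine gam_induction (p := fun g => ∃ π f, g = signed π f ∧ (∀ l, N ≤ l.val → π l = l) ∧
      ∃ ε, s + 2 ≤ N → ∀ l, N ≤ l.val → f l = ε) (by omega)
    ⟨1, _, signed_one.symm, fun _ _ => rfl, false, fun _ _ _ => rfl⟩ ?_ hg
  rintro k h1 h2 g - ⟨π, f, rfl, hπ, ε, hf⟩
  obtain ⟨k, rfl⟩ := Nat.exists_eq_add_of_le' h1
  have ht : ∀ l : Fin m, N ≤ l.val → tau m k l = l := by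
    intro l hl
    ext
    rw [tau_val (by omega)]
    split_ifs <;> omega
  refine ⟨_, _, by rw [gen, signed_mul], fun l hl => ?_, xor ε (decide (k = s)), fun hs l hl => ?_⟩
  · rw [Perm.mul_apply, hπ l hl, ht l hl]
  · rw [hf hs l hl, hπ l hl]
    have : s + 2 ≤ l.val := by omega
    simp [this]

theorem exists_signed_of_lt {k hi : ℕ} (hk : s < k) (hhi : hi ≤ m + 2) {g : Perm (Pts m)}
    (hg : g ∈ gam m s (k + 3) hi) :
    ∃ π, g = signed π (fun _ => false) ∧ ∀ l, l.val < k → π l = l := by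
  refine gam_induction (p := fun g => ∃ π, g = signed π (fun _ => false) ∧
    ∀ l, l.val < k → π l = l) hhi ⟨1, signed_one.symm, fun _ _ => rfl⟩ ?_ hg
  rintro k' h1 h2 g - ⟨π, rfl, hπ⟩
  obtain ⟨k', rfl⟩ := Nat.exists_eq_add_of_le' (show 3 ≤ k' by omega)
  refine ⟨tau m k' * π, ?_, fun l hl => ?_⟩
  · rw [gen, signed_mul]
    exact signed_congr rfl fun l => by simp; omega
  · rw [Perm.mul_apply, hπ l hl]
    ext
    rw [tau_val (by omega)]
    split_ifs <;> omega

theorem exists_signed_of_eq {hi : ℕ} (hhi : hi ≤ m + 2) {g : Perm (Pts m)}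
    (hg : g ∈ gam m s (s + 3) hi) :
    ∃ π c, g = signed π (fun l => xor (xor (decide (l.val = s)) (decide ((π l).val = s)))
      (c && decide (s ≤ l.val))) ∧ ∀ l, l.val < s → π l = l := by
  refine gam_induction (p := fun g => ∃ π c, g = signed π (fun l =>
      xor (xor (decide (l.val = s)) (decide ((π l).val = s))) (c && decide (s ≤ l.val))) ∧
      ∀ l, l.val < s → π l = l) hhi ⟨1, false, ?_, fun _ _ => rfl⟩ ?_ hg
  · rw [← signed_one]
    exact signed_congr rfl fun l => by by_cases h : l.val = s <;> simp [h]
  rintro k h1 h2 g - ⟨π, c, rfl, hπ⟩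
  obtain ⟨k, rfl⟩ := Nat.exists_eq_add_of_le' (show 3 ≤ k by omega)
  have hπ' : ∀ l : Fin m, s ≤ (π l).val ↔ s ≤ l.val := by
    intro l
    constructor
    · intro h
      by_contra h'
      rw [hπ l (by omega)] at h
      exact h' h
    · intro h
      by_contra h'
      have := hπ (π l) (by omega)
      rw [π.injective this] at h'
      exact h' h
  refine ⟨tau m k * π, xor c (decide (k = s)), ?_, fun l hl => ?_⟩
  · rw [gen, signed_mul]
    refine signed_congr rfl fun l => ?_
    have := hπ' l
    rw [Perm.mul_apply, tau_val (by omega)]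
    by_cases hks : k = s
    · subst hks
      split_ifs <;> grind
    · split_ifs <;> grind
  · rw [Perm.mul_apply, hπ l hl]
    ext
    rw [tau_val (by omega)]
    split_ifs <;> omega

theorem exists_signed_mem {k N : ℕ} (hN : N ≤ m) (π : Perm (Fin m))
    (h1 : ∀ l, l.val < k → π l = l) (h2 : ∀ l, N ≤ l.val → π l = l) :
    ∃ f, signed π f ∈ gam m s (k + 3) (N + 2) := by
  suffices h : ∀ n ≤ N, ∀ π : Perm (Fin m), (∀ l, l.val < k → π l = l) →
      (∀ l, n ≤ l.val → π l = l) → ∃ f, signed π f ∈ gam m s (k + 3) (N + 2) from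
    h N le_rfl π h1 h2
  intro n
  induction n with
  | zero =>
    intro _ π _ h2
    obtain rfl : π = 1 := Equiv.ext fun l => h2 l (Nat.zero_le _)
    exact ⟨fun _ => false, signed_one ▸ one_mem _⟩
  | succ n ih =>
    intro hn π h1 h2
    have hup : ∀ d, d ≤ n → ∀ c : Fin m, c.val + d = n → k ≤ c.val → ∃ π' f',
        signed π' f' ∈ gam m s (k + 3) (N + 2) ∧ (π' c).val = n ∧
        (∀ l : Fin m, l.val < k → π' l = l) ∧ (∀ l : Fin m, n + 1 ≤ l.val → π' l = l) := by
      intro d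
      induction d with
      | zero =>
        intro _ c hc _
        exact ⟨1, fun _ => false, signed_one ▸ one_mem _, hc, fun _ _ => rfl, fun _ _ => rfl⟩
      | succ d ihd =>
        intro hd c hc hkc
        have ht := tau_val (m := m) (k := c.val) (by omega)
        obtain ⟨π', f', hπ', h3, h4, h5⟩ := ihd (by omega) (tau m c.val c)
          (by rw [ht, if_pos rfl]; omega) (by rw [ht, if_pos rfl]; omega)
        refine ⟨π' * tau m c.val, _, by
          rw [← signed_mul]
          exact mul_mem hπ' (gen_mem_gam (m := m) (s := s) (k := c.val + 3) (by omega) (by omega)),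
          h3, fun l hl => ?_, fun l hl => ?_⟩
        · have : tau m c.val l = l := by
            ext
            rw [ht]
            split_ifs <;> omega
          rw [Perm.mul_apply, this, h4 l hl]
        · have : tau m c.val l = l := by
            ext
            rw [ht]
            split_ifs <;> omega
          rw [Perm.mul_apply, this, h5 l hl]
    by_cases hnk : n < k
    · refine ih (by omega) π h1 fun l hl => ?_
      rcases Nat.lt_or_eq_of_le hl with h | h
      · exact h2 l h
      · exact h1 l (by omega)
    set c := π ⟨n, by omega⟩ with hc
    have hck : k ≤ c.val := by
      by_contra h
      have := congrArg Fin.val (π.injective (h1 c (by omega)))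
      simp only at this
      omega
    have hcn : c.val ≤ n := by
      by_contra h
      have := congrArg Fin.val (π.injective (h2 c (by omega)))
      simp only at this
      omega
    obtain ⟨π', f', hπ', h3, h4, h5⟩ := hup (n - c.val) (by omega) c (by omega) hck
    obtain ⟨f, hf⟩ := ih (by omega) (π' * π)
      (fun l hl => by rw [Perm.mul_apply, h1 l hl, h4 l hl]) fun l hl => by
        rcases Nat.lt_or_eq_of_le hl with h | h
        · rw [Perm.mul_apply, h2 l h, h5 l h]
        · have : l = ⟨n, by omega⟩ := Fin.ext h.symm
          rw [Perm.mul_apply, this, ← hc]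
          exact Fin.ext h3
    refine ⟨fun l => xor (f l) (f' (π l)), ?_⟩
    have := mul_mem (inv_mem hπ') hf
    convert this using 1
    rw [eq_inv_mul_iff_mul_eq, signed_mul]
    exact signed_congr rfl fun l => by simp

theorem exists_flip {k N : ℕ} (hN1 : 1 ≤ N) (hN : N ≤ m) {π : Perm (Fin m)} {f : Fin m → Bool}
    (hπ : ∀ l, l.val < k → π l = l) (hg : signed π f ∈ gam m s 0 (N + 2)) :
    ∃ h ∈ gam m s (k + 3) (N + 2), ∃ f', signed π f = h * signed 1 f' := by
  obtain ⟨h, hh, hgh⟩ := exists_eq_on_tail hN1 hN hg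
  obtain ⟨π', f', rfl, hπ', -⟩ := exists_signed_of_mem_gam hN hh
  have h2 : ∀ l : Fin m, N ≤ l.val → π l = l := by
    intro l hl
    have := hgh (l, false) (Or.inl hl)
    simp only [signed_inr, Sum.inr.injEq, Prod.mk.injEq] at this
    rw [this.1, hπ' l hl]
  obtain ⟨f₁, hf₁⟩ := exists_signed_mem hN π hπ h2 (s := s)
  refine ⟨_, hf₁, fun l => xor (f l) (f₁ l), ?_⟩
  rw [signed_mul]
  exact signed_congr rfl fun l => by simp

theorem tau_mul_tau_succ_val {k : ℕ} (hk : k + 2 < m) (l : Fin m) :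
    (l.val = k ∧ ((tau m k * tau m (k + 1)) l).val = k + 1) ∨
    (l.val = k + 1 ∧ ((tau m k * tau m (k + 1)) l).val = k + 2) ∨
    (l.val = k + 2 ∧ ((tau m k * tau m (k + 1)) l).val = k) ∨
    ((l.val < k ∨ k + 2 < l.val) ∧ ((tau m k * tau m (k + 1)) l).val = l.val) := by
  rw [Perm.mul_apply, tau_val (by omega), tau_val (by omega)]
  split_ifs <;> omega

theorem tau_mul_tau_succ_cube {k : ℕ} (hk : k + 2 < m) :
    tau m k * tau m (k + 1) * (tau m k * tau m (k + 1)) * (tau m k * tau m (k + 1)) = 1 := by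
  ext l
  have h := tau_mul_tau_succ_val (m := m) hk
  generalize tau m k * tau m (k + 1) = π at h
  rw [Perm.mul_apply, Perm.mul_apply, Perm.one_apply]
  have h1 := h l
  have h2 := h (π l)
  have h3 := h (π (π l))
  omega

theorem cube_gen_eq (hm : s + 2 < m) :
    (gen m s (s + 3) * gen m s (s + 4)) ^ 3 = signed 1 fun l => decide (s ≤ l.val) := by
  have hF : gen m s (s + 3) * gen m s (s + 4) = signed (tau m s * tau m (s + 1))
      fun l => decide (l.val = s + 1 ∨ s + 3 ≤ l.val) := by
    rw [gen, gen, signed_mul]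
    refine signed_congr rfl fun l => ?_
    rw [tau_val (by omega)]
    split_ifs <;> grind
  rw [hF, pow_succ, sq, signed_mul, signed_mul]
  refine signed_congr (tau_mul_tau_succ_cube hm) fun l => ?_
  have h := tau_mul_tau_succ_val (m := m) hm
  generalize tau m s * tau m (s + 1) = π at h
  have h1 := h l
  have h2 := h (π l)
  clear h hF
  generalize (π (π l)).val = x at *
  generalize (π l).val = y at *
  generalize l.val = z at *
  grind

theorem cube_gen_three_eq (hm : 3 < m) :
    (gen m 1 3 * gen m 1 4) ^ 3 = signed 1 fun l => decide (3 ≤ l.val) := by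
  have hF : gen m 1 3 * gen m 1 4 = signed (tau m 0 * tau m (0 + 1))
      fun l => decide (3 ≤ l.val) := by
    rw [gen, gen, signed_mul]
    exact signed_congr rfl fun l => by simp
  rw [hF, pow_succ, sq, signed_mul, signed_mul]
  refine signed_congr (tau_mul_tau_succ_cube (by omega)) fun l => ?_
  have h := tau_mul_tau_succ_val (m := m) (k := 0) (by omega)
  generalize tau m 0 * tau m (0 + 1) = π at h
  have h1 := h l
  have h2 := h (π l)
  clear h hF
  generalize (π (π l)).val = x at *
  generalize (π l).val = y at *
  generalize l.val = z at *
  grind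

theorem signed_tau_conj {k N i j i' j' : ℕ} (hN : N ≤ m) (hk : k + 1 < N)
    (hi : i' = if i = k then k + 1 else if i = k + 1 then k else i)
    (hj : j' = if j = k then k + 1 else if j = k + 1 then k else j)
    (h : signed 1 (fun l : Fin m => xor (decide (l.val = i)) (decide (l.val = j)))
      ∈ gam m s 3 (N + 2)) :
    signed 1 (fun l : Fin m => xor (decide (l.val = i')) (decide (l.val = j')))
      ∈ gam m s 3 (N + 2) := by
  have hg : gen m s (k + 3) ∈ gam m s 3 (N + 2) := gen_mem_gam (by omega) (by omega)
  have h1 := tau_val (m := m) (k := k) (by omega)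
  convert mul_mem (mul_mem hg h) hg using 1
  rw [gen, signed_mul, signed_mul]
  refine signed_congr ?_ fun l => ?_
  · rw [mul_one, tau_mul_self]
  · simp only [h1, Perm.one_apply]
    split_ifs at hi hj ⊢ <;> grind

theorem flip_adjacent_mem {N : ℕ} (hN4 : 4 ≤ N) (hN : N ≤ m) {i : ℕ} (hi : i + 1 < N) :
    signed 1 (fun l : Fin m => xor (decide (l.val = i)) (decide (l.val = i + 1)))
      ∈ gam m 1 3 (N + 2) := by
  have hX : signed 1 (fun l : Fin m => decide (3 ≤ l.val)) ∈ gam m 1 3 (N + 2) := by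
    rw [← cube_gen_three_eq (by omega)]
    exact pow_mem (mul_mem (gen_mem_gam (by omega) (by omega))
      (gen_mem_gam (by omega) (by omega))) 3
  have h5 : gen m 1 5 ∈ gam m 1 3 (N + 2) := gen_mem_gam (by omega) (by omega)
  have h23 : signed 1 (fun l : Fin m => xor (decide (l.val = 2)) (decide (l.val = 2 + 1)))
      ∈ gam m 1 3 (N + 2) := by
    convert mul_mem hX (mul_mem (mul_mem h5 hX) h5) using 1
    have h1 := tau_val (m := m) (k := 2) (by omega)
    rw [gen, signed_mul, signed_mul, signed_mul]
    refine signed_congr ?_ fun l => ?_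
    · rw [mul_one, one_mul, tau_mul_self]
    · simp only [h1, Perm.mul_apply, Perm.one_apply]
      split_ifs <;> grind
  have hup : ∀ d, d + 3 < N → signed 1 (fun l : Fin m =>
      xor (decide (l.val = d + 2)) (decide (l.val = d + 2 + 1))) ∈ gam m 1 3 (N + 2) := by
    intro d
    induction d with
    | zero => exact fun _ => h23
    | succ d ih =>
      intro hd
      refine signed_tau_conj (k := d + 2) (i := d + 2) (j := d + 4) hN (by omega)
        (by simp) (by simp) ?_
      exact signed_tau_conj (k := d + 3) (i := d + 2) (j := d + 3) hN (by omega)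
        (by simp) (by simp) (ih (by omega))
  have hdown : ∀ d ≤ 2, signed 1 (fun l : Fin m =>
      xor (decide (l.val = 2 - d)) (decide (l.val = 2 - d + 1))) ∈ gam m 1 3 (N + 2) := by
    intro d
    induction d with
    | zero => exact fun _ => h23
    | succ d ih =>
      intro hd
      obtain ⟨t, ht⟩ : ∃ t, 2 - d = t + 1 := ⟨1 - d, by omega⟩
      have ht' : 2 - (d + 1) = t := by omega
      rw [ht']
      have := ih (by omega)
      rw [ht] at this
      refine signed_tau_conj (k := t + 1) (i := t) (j := t + 2) hN (by omega)
        (by split_ifs <;> omega) (by simp) ?_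
      exact signed_tau_conj (k := t) (i := t + 1) (j := t + 2) hN (by omega)
        (by simp) (by simp) this
  by_cases h : 2 ≤ i
  · have := hup (i - 2) (by omega)
    rwa [show i - 2 + 2 = i by omega] at this
  · have := hdown (2 - i) (by omega)
    rwa [show 2 - (2 - i) = i by omega] at this

theorem even_flip_mem {N : ℕ} (hN4 : 4 ≤ N) (hN : N ≤ m) (hm : Even (m - (1 + 2)))
    {f : Fin m → Bool} (hf : ∀ l, N ≤ l.val → f l = false)
    (hsign : Perm.sign (signed 1 f) = 1) : signed 1 f ∈ gam m 1 3 (N + 2) := by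
  suffices h : ∀ n ≤ N, ∀ f : Fin m → Bool, (∀ l, n ≤ l.val → f l = false) →
      Perm.sign (signed 1 f) = 1 → signed 1 f ∈ gam m 1 3 (N + 2) from h N le_rfl f hf hsign
  clear hf hsign f
  intro n
  induction n with
  | zero =>
    intro _ f hf _
    rw [funext fun l => hf l (Nat.zero_le _), signed_one]
    exact one_mem _
  | succ n ih =>
    intro hn f hf hsign
    by_cases hfn : f ⟨n, by omega⟩ = false
    · refine ih (by omega) f (fun l hl => ?_) hsign
      rcases Nat.lt_or_eq_of_le hl with h | h
      · exact hf l h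
      · rw [← hfn]
        exact congrArg f (Fin.ext h.symm)
    rw [Bool.not_eq_false] at hfn
    rcases n with _ | n
    · exfalso
      rw [sign_signed, Finset.prod_eq_single ⟨0, by omega⟩, hfn] at hsign
      · exact absurd hsign (by decide)
      · intro l _ hl
        rw [hf l (by
          have : l.val ≠ 0 := fun h => hl (Fin.ext h)
          omega)]
        simp
      · simp
    · have hP := flip_adjacent_mem hN4 hN (i := n) (by omega)
      have h1 := sign_of_mem_gam (by omega) hm (by omega) hP
      have h2 := ih (by omega) (fun l => xor (f l)
        (xor (decide (l.val = n)) (decide (l.val = n + 1)))) (fun l hl => by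
          rcases Nat.lt_or_eq_of_le hl with h | h
          · rw [hf l (by omega)]
            simp
            omega
          · have : f l = true := by
              rw [← hfn]
              exact congrArg f (Fin.ext h.symm)
            simp [this, ← h]) (by
          rw [← signed_one_mul, Perm.sign_mul, h1, hsign, one_mul])
      convert mul_mem hP h2 using 1
      rw [signed_one_mul]
      exact signed_congr rfl fun l => by rw [Bool.xor_assoc, Bool.xor_self, Bool.xor_false]

theorem gam_inf_le_of_three_le {k N : ℕ} (hs : s ≤ 1) (hsm : s + 2 < m)
    (hm : Even (m - (s + 2))) (hN : N ≤ m) (hk : k + 1 ≤ N) {g : Perm (Pts m)}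
    (h1 : g ∈ gam m s (k + 3) (m + 2)) (h2 : g ∈ gam m s 0 (N + 2)) :
    g ∈ gam m s (k + 3) (N + 2) := by
  have hmono : gam m s (k + 3) (N + 2) ≤ gam m s (k + 3) (m + 2) ⊓ gam m s 0 (N + 2) :=
    le_inf (gam_mono le_rfl (by omega)) (gam_mono (by omega) le_rfl)
  have key : (∃ π f, g = signed π f ∧ ∀ l, l.val < k → π l = l) →
      (∀ f, signed 1 f ∈ gam m s (k + 3) (m + 2) → signed 1 f ∈ gam m s 0 (N + 2) →
        signed 1 f ∈ gam m s (k + 3) (N + 2)) → g ∈ gam m s (k + 3) (N + 2) := by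
    rintro ⟨π, f, rfl, hπ⟩ H
    obtain ⟨h, hh, f', hf⟩ := exists_flip (by omega) hN hπ h2
    have h3 : signed 1 f' = h⁻¹ * signed π f := by rw [hf]; group
    rw [hf]
    refine mul_mem hh (H f' ?_ ?_)
    · rw [h3]
      exact mul_mem (inv_mem (hmono hh).1) h1
    · rw [h3]
      exact mul_mem (inv_mem (hmono hh).2) h2
  rcases lt_trichotomy k s with hks | rfl | hks
  · obtain rfl : k = 0 := by omega
    obtain rfl : s = 1 := by omega
    obtain ⟨π, f, hg, -⟩ := exists_signed_of_mem_gam le_rfl h1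
    by_cases hN4 : N ≤ 3
    · obtain ⟨h, hh, hgh⟩ := exists_eq_on_tail hk hN h2
      obtain ⟨π', f', rfl, -, -⟩ := exists_signed_of_mem_gam hN hh
      suffices h : g = signed π' f' by rwa [h]
      rw [hg]
      have : ∀ l, π l = π' l ∧ f l = f' l := by
        intro l
        simpa [hg] using hgh (l, true) (Or.inr ⟨rfl, hN4⟩)
      exact signed_congr (Equiv.ext fun l => (this l).1) fun l => (this l).2
    · refine key ⟨π, f, hg, fun l hl => absurd hl (Nat.not_lt_zero _)⟩ ?_
      intro f h1 h2
      obtain ⟨h, hh, hgh⟩ := exists_eq_on_tail hk hN h2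
      obtain ⟨π', f', rfl, -, ε, hε⟩ := exists_signed_of_mem_gam hN hh
      have hf : ∀ l : Fin m, N ≤ l.val → f l = ε := by
        intro l hl
        rw [← hε (by omega) l hl]
        simpa using congrArg (Sum.elim (fun _ => false) Prod.snd) (hgh (l, false) (Or.inl hl))
      have hX : signed 1 (fun l : Fin m => ε && decide (3 ≤ l.val)) ∈ gam m 1 3 (N + 2) := by
        cases ε
        · simp [signed_one, one_mem]
        · simp only [Bool.true_and]
          rw [← cube_gen_three_eq (by omega)]
          exact pow_mem (mul_mem (gen_mem_gam (by omega) (by omega))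
            (gen_mem_gam (by omega) (by omega))) 3
      have := even_flip_mem (f := fun l => xor (f l) (ε && decide (3 ≤ l.val)))
        (by omega) hN hm (fun l hl => by
          rw [hf l hl]
          have : 3 ≤ l.val := by omega
          simp [this]) (by
          rw [← signed_one_mul, Perm.sign_mul, sign_of_mem_gam hsm hm (by omega) hX,
            sign_of_mem_gam hsm hm le_rfl h1, one_mul])
      rw [← signed_one_mul] at this
      simpa using mul_mem (inv_mem hX) this
  · obtain ⟨π, c, hg, hπ⟩ := exists_signed_of_eq le_rfl h1
    refine key ⟨π, _, hg, hπ⟩ ?_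
    intro f h1 h2
    obtain ⟨π', c, hg', -⟩ := exists_signed_of_eq le_rfl h1
    obtain ⟨rfl, rfl⟩ := signed_injective hg'
    have hf : (fun l : Fin m => xor (xor (decide (l.val = k))
        (decide (((1 : Perm (Fin m)) l).val = k))) (c && decide (k ≤ l.val))) =
        fun l => c && decide (k ≤ l.val) :=
      funext fun l => by by_cases h : l.val = k <;> simp [h]
    rw [hf] at h2 ⊢
    cases c
    · simp [signed_one, one_mem]
    · by_cases hNk : k + 3 ≤ N
      · simp only [Bool.true_and]
        rw [← cube_gen_eq hsm]
        exact pow_mem (mul_mem (gen_mem_gam (by omega) (by omega))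
          (gen_mem_gam (by omega) (by omega))) 3
      · exfalso
        have hT : Tail k N ((⟨k, by omega⟩, true) : Fin m × Bool) := Or.inr ⟨rfl, by omega⟩
        obtain ⟨h, hh, hgh⟩ := exists_eq_on_tail (by omega) hN h2
        obtain ⟨y, hy, hhy⟩ := gam_apply_tail hN hh hT
        have := hgh _ hT
        rw [hhy] at this
        simp only [signed_inr, Sum.inr.injEq] at this
        rw [← this] at hy
        simp [Tail] at hy
        omega
  · obtain ⟨π, hg, hπ⟩ := exists_signed_of_lt hks le_rfl h1
    refine key ⟨π, _, hg, hπ⟩ ?_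
    intro f h1 _
    obtain ⟨π', hg', -⟩ := exists_signed_of_lt hks le_rfl h1
    rw [(signed_injective hg').2, signed_one]
    exact one_mem _

theorem gen_add_three_apply {k : ℕ} (hk : k + 1 < m) {l l' : Fin m} (b : Bool)
    (hl' : l'.val = if l.val = k then k + 1 else if l.val = k + 1 then k else l.val) :
    gen m s (k + 3) (inr (l, b)) = inr (l', xor b (decide (k = s ∧ s + 2 ≤ l.val))) := by
  have : tau m k l = l' := by
    ext
    rw [tau_val hk, hl']
  rw [gen, signed_inr, this]

theorem altOn_gam_two_false {N : ℕ} (hN : N ≤ m) {n : ℕ} (h2 : 2 ≤ n) (hn : n ≤ N) :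
    AltOn (gam m s 2 (N + 2))
      {x | x = inl 4 ∨ ∃ l : Fin m, x = inr (l, false) ∧ l.val < n} := by
  induction n, h2 using Nat.le_induction with
  | base =>
    set a₀ : Pts m := inr (⟨0, by omega⟩, false) with ha₀
    set a₁ : Pts m := inr (⟨1, by omega⟩, false) with ha₁
    have h0 : (Fin.ofNat m 0 : Fin m) = ⟨0, by omega⟩ := Fin.ext (Nat.mod_eq_of_lt (by omega))
    have hg2 : gen m s 2 = swap (inl 2) (inl 3) * swap (inl 4) a₀ := by rw [gen, h0]
    have hg3 : gen m s 3 a₀ = a₁ := by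
      rw [ha₀, ha₁, gen_add_three_apply (k := 0) (l' := ⟨1, by omega⟩) (by omega) _ (by simp)]
      simp
    have hc : cyc a₀ (inl 4) a₁ ∈ gam m s 2 (N + 2) := by
      have h3 : gen m s 3 * gen m s 2 * (gen m s 3)⁻¹ =
          swap (inl 2) (inl 3) * swap (inl 4) a₁ := by
        rw [hg2, ← hg3, ← conj_mul, ← swap_apply_apply, ← swap_apply_apply]
        rfl
      have h4 : Commute (swap (inl 4) a₀) (swap (inl 2 : Pts m) (inl 3)) :=
        commute_swap_of_fixed (by simp [swap_apply_of_ne_of_ne, ha₀])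
          (by simp [swap_apply_of_ne_of_ne, ha₀])
      have h5 : cyc a₀ (inl 4) a₁ = gen m s 2 * (gen m s 3 * gen m s 2 * (gen m s 3)⁻¹) := by
        rw [h3, hg2, ← h4.eq, cyc, swap_comm a₀]
        simp [mul_assoc]
      rw [h5]
      have m2 : gen m s 2 ∈ gam m s 2 (N + 2) := gen_mem_gam le_rfl (by omega)
      have m3 : gen m s 3 ∈ gam m s 2 (N + 2) := gen_mem_gam (by omega) (by omega)
      exact mul_mem m2 (mul_mem (mul_mem m3 m2) (inv_mem m3))
    refine altOn_of_pair (x := a₀) (y := inl 4) (by simp [ha₀]) ?_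
    rintro w (rfl | ⟨l, rfl, hl⟩) h1 h2
    · exact absurd rfl h2
    · have : l.val ≠ 0 := fun h => h1 (by simp [ha₀, Fin.ext_iff, h])
      have : l = ⟨1, by omega⟩ := Fin.ext (by simp; omega)
      rwa [this]
  | succ n h2 ih =>
    obtain ⟨n, rfl⟩ := Nat.exists_eq_add_of_le' (show 1 ≤ n by omega)
    have hg : gen m s (n + 3) ∈ gam m s 2 (N + 2) := gen_mem_gam (by omega) (by omega)
    have e0 := gen_add_three_apply (m := m) (s := s) (k := n) (by omega) (l := ⟨0, by omega⟩)
      (l' := ⟨0, by omega⟩) false (by simp; omega)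
    have e1 := gen_add_three_apply (m := m) (s := s) (k := n) (by omega) (l := ⟨n, by omega⟩)
      (l' := ⟨n + 1, by omega⟩) false (by simp)
    rw [show decide (n = s ∧ s + 2 ≤ n) = false by simp; omega] at e1
    have := altOn_insert_map (ih (by omega)) (x := inl 4) (y := inr (⟨0, by omega⟩, false))
      (z := inr (⟨n, by omega⟩, false)) (Or.inl rfl) (Or.inr ⟨_, rfl, by simp⟩)
      (Or.inr ⟨_, rfl, by simp⟩) (by simp) (by simp) (by simp; omega) hg (Or.inl rfl)
      (Or.inr ⟨⟨0, by omega⟩, by rw [e0]; simp, by simp⟩)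
    rw [e1] at this
    refine this.mono le_rfl ?_
    rintro _ (rfl | ⟨l, rfl, hl⟩)
    · exact Or.inr (Or.inl rfl)
    · rcases Nat.lt_succ_iff_lt_or_eq.1 hl with hl | hl
      · exact Or.inr (Or.inr ⟨l, rfl, hl⟩)
      · exact Or.inl (by simp [Fin.ext_iff, hl])

theorem altOn_gam_two_true {N : ℕ} (hN : N ≤ m) (hs : s + 3 ≤ N) {n : ℕ} (hn : n + 1 ≤ N) :
    AltOn (gam m s 2 (N + 2))
      {x | x = inl 4 ∨ ∃ l : Fin m, ∃ b, x = inr (l, b) ∧ l.val < N ∧ (b = true → n ≤ l.val)} := by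
  obtain ⟨d, hd⟩ := Nat.exists_eq_add_of_le hn
  induction d generalizing n with
  | zero =>
    have hg : gen m s (s + 3) ∈ gam m s 2 (N + 2) := gen_mem_gam (by omega) (by omega)
    have e0 := gen_add_three_apply (m := m) (s := s) (k := s) (by omega) (l := ⟨s, by omega⟩)
      (l' := ⟨s + 1, by omega⟩) false (by simp)
    have e1 := gen_add_three_apply (m := m) (s := s) (k := s) (by omega) (l := ⟨n, by omega⟩)
      (l' := ⟨n, by omega⟩) false (by simp only; split_ifs <;> omega)
    rw [show decide (s = s ∧ s + 2 ≤ n) = true by simp; omega] at e1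
    have := altOn_insert_map (altOn_gam_two_false (s := s) hN (by omega) le_rfl) (x := inl 4)
      (y := inr (⟨s, by omega⟩, false)) (z := inr (⟨n, by omega⟩, false)) (Or.inl rfl)
      (Or.inr ⟨_, rfl, by simp; omega⟩) (Or.inr ⟨_, rfl, by simp; omega⟩) (by simp) (by simp)
      (by simp; omega) hg (Or.inl rfl)
      (Or.inr ⟨⟨s + 1, by omega⟩, by rw [e0]; simp, by simp; omega⟩)
    rw [e1] at this
    refine this.mono le_rfl ?_
    rintro _ (rfl | ⟨l, b, rfl, hl, hb⟩)
    · exact Or.inr (Or.inl rfl)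
    · cases b
      · exact Or.inr (Or.inr ⟨l, rfl, hl⟩)
      · have := hb rfl
        exact Or.inl (by simp [Fin.ext_iff]; omega)
  | succ d ih =>
    have hg : gen m s (n + 3) ∈ gam m s 2 (N + 2) := gen_mem_gam (by omega) (by omega)
    have e0 := gen_add_three_apply (m := m) (s := s) (k := n) (by omega) (l := ⟨n + 1, by omega⟩)
      (l' := ⟨n, by omega⟩) false (by simp)
    have e1 := gen_add_three_apply (m := m) (s := s) (k := n) (by omega) (l := ⟨n + 1, by omega⟩)
      (l' := ⟨n, by omega⟩) true (by simp)
    rw [show decide (n = s ∧ s + 2 ≤ n + 1) = false by simp; omega] at e0 e1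
    have := altOn_insert_map (ih (n := n + 1) (by omega) (by omega)) (x := inl 4)
      (y := inr (⟨n + 1, by omega⟩, false)) (z := inr (⟨n + 1, by omega⟩, true)) (Or.inl rfl)
      (Or.inr ⟨_, _, rfl, by simp; omega, by simp⟩) (Or.inr ⟨_, _, rfl, by simp; omega, by simp⟩)
      (by simp) (by simp) (by simp) hg (Or.inl rfl)
      (Or.inr ⟨_, _, e0, by simp; omega, by simp⟩)
    rw [e1] at this
    refine this.mono le_rfl ?_
    rintro _ (rfl | ⟨l, b, rfl, hl, hb⟩)
    · exact Or.inr (Or.inl rfl)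
    · by_cases h : b = true ∧ l.val = n
      · exact Or.inl (by simp [Fin.ext_iff, h])
      · refine Or.inr (Or.inr ⟨l, b, rfl, hl, fun h' => ?_⟩)
        have := hb h'
        have : l.val ≠ n := fun h'' => h ⟨h', h''⟩
        omega

theorem altOn_gam_two {N : ℕ} (h2 : 2 ≤ N) (hN : N ≤ m) :
    AltOn (gam m s 2 (N + 2)) {x | x = inl 4 ∨ ∃ y, x = inr y ∧ ¬Tail s N y} := by
  by_cases hs : s + 3 ≤ N
  · refine (altOn_gam_two_true (n := 0) hN hs (by omega)).mono le_rfl ?_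
    rintro _ (rfl | ⟨⟨l, b⟩, rfl, hl⟩)
    · exact Or.inl rfl
    · exact Or.inr ⟨l, b, rfl, by simp [Tail] at hl; omega, fun _ => Nat.zero_le _⟩
  · refine (altOn_gam_two_false hN h2 le_rfl).mono le_rfl ?_
    rintro _ (rfl | ⟨⟨l, b⟩, rfl, hl⟩)
    · exact Or.inl rfl
    · simp only [Tail, not_or, not_and, not_le] at hl
      cases b
      · exact Or.inr ⟨l, rfl, hl.1⟩
      · have := hl.2 rfl
        omega

theorem altOn_gam_one {N : ℕ} (h2 : 2 ≤ N) (hN : N ≤ m) :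
    AltOn (gam m s 1 (N + 2))
      {x | (∃ c, x = inl c ∧ c ≠ 0) ∨ ∃ y, x = inr y ∧ ¬Tail s N y} := by
  have ha : ∀ k (hk : k < N), ¬Tail s N ((⟨k, by omega⟩, false) : Fin m × Bool) := by
    intro k hk
    simp [Tail, hk]
  have h0 : (Fin.ofNat m 0 : Fin m) = ⟨0, by omega⟩ := Fin.ext (Nat.mod_eq_of_lt (by omega))
  have g1 : gen m s 1 ∈ gam m s 1 (N + 2) := gen_mem_gam le_rfl (by omega)
  have g2 : gen m s 2 ∈ gam m s 1 (N + 2) := gen_mem_gam (by omega) (by omega)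
  have e1 : ∀ x, gen m s 1 (inr x) = inr x := by simp [gen, swap_apply_of_ne_of_ne]
  have e2 : gen m s 2 (inr (⟨0, by omega⟩, false)) = inl 4 := by
    simp [gen, swap_apply_of_ne_of_ne]
  have e3 : gen m s 2 (inr (⟨1, by omega⟩, false)) = inr (⟨1, by omega⟩, false) := by
    simp [gen, swap_apply_of_ne_of_ne]
  have e4 : gen m s 1 (inl 4) = inl 3 := by simp [gen, swap_apply_of_ne_of_ne]
  have e5 : gen m s 2 (inl 3) = inl 2 := by simp [gen, swap_apply_of_ne_of_ne]
  have e6 : gen m s 1 (inl 2) = inl 1 := by simp [gen, swap_apply_of_ne_of_ne]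
  have k1 := altOn_insert_map ((altOn_gam_two (s := s) h2 hN).mono
    (gam_mono (by omega) le_rfl) subset_rfl) (x := inr (⟨0, by omega⟩, false))
    (y := inr (⟨1, by omega⟩, false)) (z := inl 4) (Or.inr ⟨_, rfl, ha _ (by omega)⟩)
    (Or.inr ⟨_, rfl, ha _ (by omega)⟩) (Or.inl rfl) (by simp) (by simp) (by simp) g1
    (Or.inr ⟨_, e1 _, ha _ (by omega)⟩) (Or.inr ⟨_, e1 _, ha _ (by omega)⟩)
  rw [e4] at k1
  have k2 := altOn_insert_map k1 (x := inr (⟨0, by omega⟩, false))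
    (y := inr (⟨1, by omega⟩, false)) (z := inl 3) (Or.inr (Or.inr ⟨_, rfl, ha _ (by omega)⟩))
    (Or.inr (Or.inr ⟨_, rfl, ha _ (by omega)⟩)) (Or.inl rfl) (by simp) (by simp) (by simp) g2
    (Or.inr (Or.inl e2)) (Or.inr (Or.inr ⟨_, e3, ha _ (by omega)⟩))
  rw [e5] at k2
  have k3 := altOn_insert_map k2 (x := inr (⟨0, by omega⟩, false))
    (y := inr (⟨1, by omega⟩, false)) (z := inl 2)
    (Or.inr (Or.inr (Or.inr ⟨_, rfl, ha _ (by omega)⟩)))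
    (Or.inr (Or.inr (Or.inr ⟨_, rfl, ha _ (by omega)⟩))) (Or.inl rfl) (by simp) (by simp) (by simp)
    g1 (Or.inr (Or.inr (Or.inr ⟨_, e1 _, ha _ (by omega)⟩)))
    (Or.inr (Or.inr (Or.inr ⟨_, e1 _, ha _ (by omega)⟩)))
  rw [e6] at k3
  refine k3.mono le_rfl ?_
  rintro _ (⟨c, rfl, hc⟩ | ⟨y, rfl, hy⟩)
  · fin_cases c <;> simp at hc ⊢
  · exact Or.inr (Or.inr (Or.inr (Or.inr ⟨y, rfl, hy⟩)))

theorem altOn_gam_zero {N : ℕ} (h2 : 2 ≤ N) (hN : N ≤ m) :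
    AltOn (gam m s 0 (N + 2))
      {x | (∃ c, x = inl c) ∨ ∃ y, x = inr y ∧ ¬Tail s N y} := by
  have g0 : gen m s 0 ∈ gam m s 0 (N + 2) := gen_mem_gam le_rfl (by omega)
  have e0 : gen m s 0 (inl 1) = inl 0 := by simp [gen, swap_apply_of_ne_of_ne]
  have k := altOn_insert_map ((altOn_gam_one (s := s) h2 hN).mono
    (gam_mono (by omega) le_rfl) subset_rfl) (x := inl 2) (y := inl 3) (z := inl 1)
    (Or.inl ⟨_, rfl, by simp⟩) (Or.inl ⟨_, rfl, by simp⟩) (Or.inl ⟨_, rfl, by simp⟩)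
    (by simp) (by simp) (by simp) g0 (Or.inl ⟨3, by simp [gen, swap_apply_of_ne_of_ne]⟩)
    (Or.inl ⟨2, by simp [gen, swap_apply_of_ne_of_ne]⟩)
  rw [e0] at k
  refine k.mono le_rfl ?_
  rintro _ (⟨c, rfl⟩ | ⟨y, rfl, hy⟩)
  · by_cases hc : c = 0
    · exact Or.inl (by rw [hc])
    · exact Or.inr (Or.inl ⟨c, rfl, hc⟩)
  · exact Or.inr (Or.inr ⟨y, rfl, hy⟩)

theorem gen_relations :
    (gen m s 0 * gen m s 1) ^ 5 = 1 ∧ (gen m s 1 * gen m s 2) ^ 5 = 1 ∧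
    gen m s 0 * gen m s 1 * gen m s 0 * gen m s 2 * gen m s 1 * gen m s 0 =
      gen m s 1 * gen m s 2 * gen m s 1 * gen m s 2 * gen m s 1 * gen m s 2 * gen m s 1 ∧
    gen m s 0 * gen m s 1 * gen m s 0 * gen m s 1 * gen m s 2 * gen m s 1 * gen m s 2 *
      gen m s 1 * gen m s 0 * gen m s 1 * gen m s 0 =
      gen m s 1 * gen m s 2 * gen m s 1 * gen m s 2 * gen m s 1 := by
  have e (k : ℕ) (hk : k ≤ 2) (x) (hx : x ≠ ((0 : Fin m), false)) : gen m s k (inr x) = inr x := by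
    interval_cases k <;> simp [gen, swap_apply_of_ne_of_ne, hx]
  have e0 : gen m s 0 (inl 0) = inl 1 ∧ gen m s 0 (inl 1) = inl 0 ∧ gen m s 0 (inl 2) = inl 3 ∧
      gen m s 0 (inl 3) = inl 2 ∧ gen m s 0 (inl 4) = inl 4 ∧
      gen m s 0 (inr (0, false)) = inr (0, false) := by simp [gen, swap_apply_of_ne_of_ne]
  have e1 : gen m s 1 (inl 0) = inl 0 ∧ gen m s 1 (inl 1) = inl 2 ∧ gen m s 1 (inl 2) = inl 1 ∧
      gen m s 1 (inl 3) = inl 4 ∧ gen m s 1 (inl 4) = inl 3 ∧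
      gen m s 1 (inr (0, false)) = inr (0, false) := by simp [gen, swap_apply_of_ne_of_ne]
  have e2 : gen m s 2 (inl 0) = inl 0 ∧ gen m s 2 (inl 1) = inl 1 ∧ gen m s 2 (inl 2) = inl 3 ∧
      gen m s 2 (inl 3) = inl 2 ∧ gen m s 2 (inl 4) = inr (0, false) ∧
      gen m s 2 (inr (0, false)) = inl 4 := by simp [gen, swap_apply_of_ne_of_ne]
  have f0 := e 0 (by omega)
  have f1 := e 1 (by omega)
  have f2 := e 2 (by omega)
  generalize gen m s 0 = a at *
  generalize gen m s 1 = b at *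
  generalize gen m s 2 = c at *
  refine ⟨?_, ?_, ?_, ?_⟩
  all_goals
    ext x
    rcases x with x | x
    · fin_cases x <;> simp [pow_succ, e0, e1, e2]
    · by_cases hx : x = (0, false)
      · simp [pow_succ, e0, e1, e2, hx]
      · simp [pow_succ, hx, f0, f1, f2]

theorem exists_fixing_tail {lo N : ℕ} (hlo : lo ≤ 3) (hN1 : 1 ≤ N) (hN : N ≤ m)
    {g : Perm (Pts m)} (h1 : g ∈ gam m s lo (m + 2)) (h2 : g ∈ gam m s 0 (N + 2)) :
    ∃ h ∈ gam m s 3 (N + 2), h⁻¹ * g ∈ gam m s lo (m + 2) ∧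
      ∀ x, Tail s N x → (h⁻¹ * g) (inr x) = inr x := by
  obtain ⟨h, hh, hgh⟩ := exists_eq_on_tail hN1 hN h2
  refine ⟨h, hh, mul_mem (inv_mem (gam_mono hlo (by omega) hh)) h1, fun x hx => ?_⟩
  rw [Perm.mul_apply, hgh x hx, Perm.inv_eq_iff_eq]

theorem gen_apply_inl_zero : ∀ {k : ℕ}, 1 ≤ k → gen m s k (inl 0) = inl 0
  | 1, _ => by simp [gen, swap_apply_of_ne_of_ne]
  | 2, _ => by simp [gen, swap_apply_of_ne_of_ne]
  | _ + 3, _ => rfl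

theorem gam_one_apply {hi : ℕ} (hhi : hi ≤ m + 2) {g : Perm (Pts m)} (hg : g ∈ gam m s 1 hi) :
    g (inl 0) = inl 0 := by
  refine gam_induction (p := fun g => g (inl 0) = inl 0) hhi rfl ?_ hg
  rintro k h1 - g - ih
  rw [Perm.mul_apply, ih, gen_apply_inl_zero h1]

theorem gam_two_apply {hi : ℕ} (hhi : hi ≤ m + 2) {g : Perm (Pts m)} (hg : g ∈ gam m s 2 hi) :
    g (inl 1) = inl 1 ∧
      (g (inl 2) = inl 2 ∧ g (inl 3) = inl 3 ∨ g (inl 2) = inl 3 ∧ g (inl 3) = inl 2) := by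
  refine gam_induction (p := fun g => g (inl 1) = inl 1 ∧
    (g (inl 2) = inl 2 ∧ g (inl 3) = inl 3 ∨ g (inl 2) = inl 3 ∧ g (inl 3) = inl 2))
    hhi (by simp) ?_ hg
  rintro k h1 - g - ⟨ih1, ih2⟩
  simp only [Perm.mul_apply, ih1]
  match k, h1 with
  | 2, _ => rcases ih2 with ih2 | ih2 <;> simp [gen, swap_apply_of_ne_of_ne, ih2]
  | k + 3, _ => rcases ih2 with ih2 | ih2 <;> simp [gen, ih2]

theorem gam_one_inf_le {N : ℕ} (hsm : s + 2 < m) (hm : Even (m - (s + 2))) (h2 : 2 ≤ N)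
    (hN : N ≤ m) {g : Perm (Pts m)} (h1 : g ∈ gam m s 1 (m + 2)) (hg : g ∈ gam m s 0 (N + 2)) :
    g ∈ gam m s 1 (N + 2) := by
  obtain ⟨h, hh, hg', hT⟩ := exists_fixing_tail (by omega) (by omega) hN h1 hg
  have hh' := gam_mono (show 1 ≤ 3 by omega) le_rfl hh
  rw [← mul_mem_cancel_left (inv_mem hh')]
  refine (altOn_gam_one h2 hN).mem_of_even (sign_of_mem_gam hsm hm le_rfl hg') ?_
  rintro (c | x) hx
  · obtain rfl : c = 0 := by simpa using hx
    exact gam_one_apply le_rfl hg'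
  · exact hT x (by_contra fun h => hx (Or.inr ⟨x, rfl, h⟩))

theorem gam_two_inf_le {N : ℕ} (hsm : s + 2 < m) (hm : Even (m - (s + 2))) (h2 : 2 ≤ N)
    (hN : N ≤ m) {g : Perm (Pts m)} (h1 : g ∈ gam m s 2 (m + 2)) (hg : g ∈ gam m s 0 (N + 2)) :
    g ∈ gam m s 2 (N + 2) := by
  obtain ⟨h, hh, hg', hT⟩ := exists_fixing_tail (by omega) (by omega) hN h1 hg
  have hh' := gam_mono (show 2 ≤ 3 by omega) le_rfl hh
  rw [← mul_mem_cancel_left (inv_mem hh')]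
  generalize h⁻¹ * g = g at hg' hT
  have m2 : ∀ N, gen m s 2 ∈ gam m s 2 (N + 2 + 1) := fun N => gen_mem_gam le_rfl (by omega)
  have key : ∀ g ∈ gam m s 2 (m + 2), (∀ x, Tail s N x → g (inr x) = inr x) →
      g (inl 2) = inl 2 ∧ g (inl 3) = inl 3 → g ∈ gam m s 2 (N + 2) := by
    intro g hg' hT h23
    refine (altOn_gam_two h2 hN).mem_of_even (sign_of_mem_gam hsm hm le_rfl hg') ?_
    rintro (c | x) hx
    · fin_cases c
      · exact gam_one_apply le_rfl (gam_mono (by omega) le_rfl hg')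
      · exact (gam_two_apply le_rfl hg').1
      · exact h23.1
      · exact h23.2
      · simp at hx
    · exact hT x (by_contra fun h => hx (Or.inr ⟨x, rfl, h⟩))
  rcases (gam_two_apply le_rfl hg').2 with h23 | h23
  · exact key g hg' hT h23
  · have hm2 : gen m s 2 ∈ gam m s 2 (N + 2) := gen_mem_gam le_rfl (by omega)
    rw [← mul_mem_cancel_left hm2]
    refine key _ (mul_mem (gen_mem_gam le_rfl (by omega)) hg') (fun x hx => ?_) ?_
    · rw [Perm.mul_apply, hT x hx, gen_apply_tail_of_le_two le_rfl (by omega) hx]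
    · simp [gen, swap_apply_of_ne_of_ne, h23]

theorem gam_succ_right {lo hi : ℕ} (h : lo ≤ hi) :
    gam m s lo (hi + 1) = closure (insert (gen m s hi) (gen m s '' Set.Ico lo hi)) := by
  rw [gam, ← Set.image_insert_eq, Set.insert_Ico_right_eq_Ico_add_one h]

theorem gam_succ_self (k : ℕ) : gam m s k (k + 1) = closure {gen m s k} := by
  simp [gam_succ_right le_rfl]

theorem gam_self_add_two (k : ℕ) : gam m s k (k + 2) = closure {gen m s k, gen m s (k + 1)} := by
  rw [gam_succ_right (by omega), Set.Ico_add_one_right_eq_Icc]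
  simp [Set.pair_comm]

theorem gam_zero_three : gam m s 0 3 = closure {gen m s 0, gen m s 1, gen m s 2} := by
  have : Set.Ico 0 3 = ({0, 1, 2} : Set ℕ) := by
    ext x
    simp
    omega
  rw [gam, this]
  simp [Set.image_insert_eq]

theorem gen_zero_apply_inl_zero : gen m s 0 (inl 0) = inl 1 := by
  simp [gen, swap_apply_of_ne_of_ne]

theorem gam_one_inf_low {j : ℕ} (hm4 : 4 ≤ m) (h1 : 1 ≤ j) (hj : j ≤ 3) {g : Perm (Pts m)}
    (hg : g ∈ gam m s 1 (m + 2)) (hg' : g ∈ gam m s 0 j) : g ∈ gam m s 1 j := by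
  have hg0 := gam_one_apply le_rfl hg
  have i (k : ℕ) (hk : k ≤ 2) : gen m s k * gen m s k = 1 := gen_mul_self (by omega)
  interval_cases j
  · rw [gam_succ_self] at hg'
    rcases mem_closure_singleton_of_mul_self (i 0 (by omega)) hg' with rfl | rfl
    · exact one_mem _
    · simp [gen_zero_apply_inl_zero] at hg0
  · rw [gam_self_add_two] at hg'
    rw [gam_succ_self]
    refine mem_closure_of_fixed_of_pow_five (i 0 (by omega)) (i 1 (by omega))
      gen_relations.1 ?_ ?_ ?_ ?_ ?_ hg' hg0 <;> simp [gen, swap_apply_of_ne_of_ne]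
  · rw [gam_zero_three] at hg'
    rw [gam_self_add_two]
    refine mem_closure_pair_of_fixed (i 0 (by omega)) (i 1 (by omega)) (i 2 (by omega))
      (gen_commute (by omega) (by omega)).eq gen_relations.1 gen_relations.2.2.1
      gen_relations.2.2.2 ?_ ?_ ?_ ?_ ?_ ?_ ?_ hg' hg0 <;> simp [gen, swap_apply_of_ne_of_ne]

theorem gam_two_inf_low {j : ℕ} (hm4 : 4 ≤ m) (h1 : 2 ≤ j) (hj : j ≤ 3) {g : Perm (Pts m)}
    (hg : g ∈ gam m s 2 (m + 2)) (hg' : g ∈ gam m s 0 j) : g ∈ gam m s 2 j := by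
  have hg1 := (gam_two_apply le_rfl hg).1
  have i (k : ℕ) (hk : k ≤ 2) : gen m s k * gen m s k = 1 := gen_mul_self (by omega)
  have hlow := gam_one_inf_low hm4 (by omega) hj (gam_mono (by omega) le_rfl hg) hg'
  interval_cases j
  · rw [gam_succ_self] at hlow
    rcases mem_closure_singleton_of_mul_self (i 1 (by omega)) hlow with rfl | rfl
    · exact one_mem _
    · simp [gen, swap_apply_of_ne_of_ne] at hg1
  · rw [gam_self_add_two] at hlow
    rw [gam_succ_self]
    refine mem_closure_of_fixed_of_pow_five (i 1 (by omega)) (i 2 (by omega))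
      gen_relations.2.1 ?_ ?_ ?_ ?_ ?_ hlow hg1 <;> simp [gen, swap_apply_of_ne_of_ne]

theorem gam_inf_le (hs : s ≤ 1) (hm4 : 4 ≤ m) (hm : Even (m - (s + 2))) {i j : ℕ} (hij : i < j)
    (hj : j ≤ m + 2) : gam m s (i + 1) (m + 2) ⊓ gam m s 0 j ≤ gam m s (i + 1) j := by
  rintro g ⟨h1, h2⟩
  by_cases h3 : j ≤ 3 ∧ i ≤ 1
  · obtain rfl | rfl : i = 0 ∨ i = 1 := by omega
    · exact gam_one_inf_low hm4 (by omega) (by omega) h1 h2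
    · exact gam_two_inf_low hm4 (by omega) (by omega) h1 h2
  obtain ⟨N, rfl⟩ := Nat.exists_eq_add_of_le' (show 2 ≤ j by omega)
  match i with
  | 0 => exact gam_one_inf_le (by omega) hm (by omega) (by omega) h1 h2
  | 1 => exact gam_two_inf_le (by omega) hm (by omega) (by omega) h1 h2
  | i + 2 => exact gam_inf_le_of_three_le hs (by omega) hm (by omega) (by omega) h1 h2

theorem image_gen_eq {d r : ℕ} (I : Set (Fin r)) (J : Set ℕ)
    (h : ∀ k, k ∈ J ↔ ∃ i ∈ I, i.val + d = k) :
    (fun i : Fin r => gen m s (i.val + d)) '' I = gen m s '' J := by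
  ext g
  constructor
  · rintro ⟨i, hi, rfl⟩
    exact ⟨_, (h _).2 ⟨i, hi, rfl⟩, rfl⟩
  · rintro ⟨k, hk, rfl⟩
    obtain ⟨i, hi, rfl⟩ := (h k).1 hk
    exact ⟨i, hi, rfl⟩

theorem exists_isStringCGroupRep_of_gen (hs : s ≤ 1) (hm4 : 4 ≤ m) (hm : Even (m - (s + 2)))
    {d r n : ℕ} (hd : r + d = m + 2) (φ : Fin n ↪ Pts m)
    (hfix : ∀ k x, d ≤ k → x ∉ Set.range φ → gen m s k x = x)
    (hgen : AltOn (gam m s d (m + 2)) (Set.range φ)) :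
    ∃ ρ : Fin r → alternatingGroup (Fin n), IsStringCGroupRep ρ := by
  refine exists_isStringCGroupRep_of_embedding φ (fun i : Fin r => gen m s (i.val + d))
    (fun i => orderOf_gen (by omega)) (fun i => sign_gen (by omega) (by omega) hm)
    (fun i x hx => hfix _ x (by omega) hx) (fun i j hij => gen_commute (by omega) (by omega))
    (fun g hg hgφ => ?_) (fun i j hij => ?_)
  · rw [← Set.image_univ, image_gen_eq Set.univ (Set.Ico d (m + 2))]
    · exact hgen.mem_of_even hg hgφ
    · intro k
      simp only [Set.mem_Ico, Set.mem_univ, true_and]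
      exact ⟨fun hk => ⟨⟨k - d, by omega⟩, by simp; omega⟩, by rintro ⟨i, rfl⟩; omega⟩
  · rw [image_gen_eq (Set.Ioi i) (Set.Ico (i.val + d + 1) (m + 2)),
      image_gen_eq (Set.Iio j) (Set.Ico d (j.val + d)),
      image_gen_eq (Set.Ioo i j) (Set.Ico (i.val + d + 1) (j.val + d))]
    · have hij' : i.val < j.val := hij
      exact (inf_le_inf_left _ (gam_mono (Nat.zero_le d) le_rfl)).trans
        (gam_inf_le hs hm4 hm (by omega) (by omega))
    · intro k
      simp only [Set.mem_Ico, Set.mem_Ioo, Fin.lt_def]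
      exact ⟨fun hk => ⟨⟨k - d, by omega⟩, by simp; omega⟩, by rintro ⟨i, hi, rfl⟩; omega⟩
    · intro k
      simp only [Set.mem_Ico, Set.mem_Iio, Fin.lt_def]
      exact ⟨fun hk => ⟨⟨k - d, by omega⟩, by simp; omega⟩, by rintro ⟨i, hi, rfl⟩; omega⟩
    · intro k
      simp only [Set.mem_Ico, Set.mem_Ioi, Fin.lt_def]
      exact ⟨fun hk => ⟨⟨k - d, by omega⟩, by simp; omega⟩, by rintro ⟨i, hi, rfl⟩; omega⟩

theorem exists_isStringCGroupRep_of_twelve_le {n : ℕ} (hn : 12 ≤ n) :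
    ∃ ρ : Fin ((n - 1) / 2) → alternatingGroup (Fin n), IsStringCGroupRep ρ := by
  obtain ⟨m, hm, h⟩ : ∃ m, 4 ≤ m ∧ (n = 2 * m + 5 ∨ n = 2 * m + 4) :=
    ⟨(n - 4) / 2, by omega, by omega⟩
  have : NeZero m := ⟨by omega⟩
  have hs : m % 2 ≤ 1 := by omega
  have hev : Even (m - (m % 2 + 2)) := by
    rw [Nat.even_iff]
    omega
  rcases h with rfl | rfl
  · have hcard : Fintype.card (Pts m) = 2 * m + 5 := by
      simp
      omega
    refine exists_isStringCGroupRep_of_gen hs hm hev (d := 0) (by omega)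
      ((Fintype.equivFinOfCardEq hcard).symm.toEmbedding) ?_ ?_
    · intro k x _ hx
      simp at hx
    · refine (altOn_gam_zero (by omega) le_rfl).mono le_rfl ?_
      rintro (c | x) _
      · exact Or.inl ⟨c, rfl⟩
      · refine Or.inr ⟨x, rfl, ?_⟩
        simp [Tail]
        omega
  · have hcard : Fintype.card {x : Pts m // x ≠ inl 0} = 2 * m + 4 := by
      simp [Fintype.card_subtype_compl]
      omega
    have hr : Set.range ((Fintype.equivFinOfCardEq hcard).symm.toEmbedding.trans
        (Function.Embedding.subtype _)) = {x | x ≠ inl 0} := by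
      ext x
      refine ⟨?_, fun hx => ⟨Fintype.equivFinOfCardEq hcard ⟨x, hx⟩, by simp⟩⟩
      rintro ⟨y, rfl⟩
      exact ((Fintype.equivFinOfCardEq hcard).symm y).2
    refine exists_isStringCGroupRep_of_gen hs hm hev (d := 1) (by omega)
      ((Fintype.equivFinOfCardEq hcard).symm.toEmbedding.trans
        (Function.Embedding.subtype _)) ?_ ?_
    · intro k x hk hx
      rw [hr, Set.mem_ofPred_eq, not_not] at hx
      rw [hx, gen_apply_inl_zero hk]
    · rw [hr]
      refine (altOn_gam_one (by omega) le_rfl).mono le_rfl ?_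
      rintro (c | x) hx
      · exact Or.inl ⟨c, rfl, fun h => hx (by rw [h])⟩
      · refine Or.inr ⟨x, rfl, ?_⟩
        simp [Tail]
        omega

end Groups

section RankFour

variable {n : ℕ} {a b c d : Perm (Fin n)}

theorem exists_isStringCGroupRep_of_four
    (h2 : ∀ g ∈ ({a, b, c, d} : Set (Perm (Fin n))), g * g = 1)
    (h1 : ∀ g ∈ ({a, b, c, d} : Set (Perm (Fin n))), g ≠ 1)
    (hsign : ∀ g ∈ ({a, b, c, d} : Set (Perm (Fin n))), Perm.sign g = 1)
    (hac : Commute a c) (had : Commute a d) (hbd : Commute b d)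
    (hgen : AltOn (closure {a, b, c, d}) Set.univ)
    (hI₀ : a ∉ closure {b, c, d}) (hI₃ : d ∉ closure {a, b, c})
    (hI₁ : ∀ g ∈ closure {b, c, d}, g ∈ closure {a, b} → g ∈ closure {b})
    (hI₂ : ∀ g ∈ closure {c, d}, g ∈ closure {a, b, c} → g ∈ closure {c})
    (hI₁₂ : ∀ g ∈ closure {c, d}, g ∈ closure {a, b} → g = 1)
    (hI : ∀ g ∈ closure {b, c, d}, g ∈ closure {a, b, c} → g ∈ closure {b, c}) :
    ∃ ρ : Fin 4 → alternatingGroup (Fin n), IsStringCGroupRep ρ := by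
  have ha2 := h2 a (by simp)
  have hd2 := h2 d (by simp)
  have hmem : ∀ i, ![a, b, c, d] i ∈ ({a, b, c, d} : Set (Perm (Fin n))) := by
    intro i
    fin_cases i <;> simp
  have hrange : Set.range ![a, b, c, d] = {a, b, c, d} := by
    refine Set.Subset.antisymm (Set.range_subset_iff.2 hmem) ?_
    rintro _ (rfl | rfl | rfl | rfl)
    exacts [⟨0, rfl⟩, ⟨1, rfl⟩, ⟨2, rfl⟩, ⟨3, rfl⟩]
  have himage (I : Set (Fin 4)) (J : Set (Perm (Fin n))) (h : ∀ i ∈ I, ![a, b, c, d] i ∈ J) :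
      closure (![a, b, c, d] '' I) ≤ closure J :=
    closure_mono (Set.image_subset_iff.2 h)
  have himage' (I : Set (Fin 4)) (J : Set (Perm (Fin n))) (h : J ⊆ ![a, b, c, d] '' I) :
      closure J ≤ closure (![a, b, c, d] '' I) := closure_mono h
  refine exists_isStringCGroupRep_of_embedding (Function.Embedding.refl _) ![a, b, c, d]
    (fun i => orderOf_eq_prime (by rw [sq, h2 _ (hmem i)]) (h1 _ (hmem i)))
    (fun i => hsign _ (hmem i)) (fun i x hx => absurd ⟨x, rfl⟩ hx) ?_ ?_ ?_
  · intro i j hij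
    fin_cases i <;> fin_cases j <;> simp at hij <;> assumption
  · intro g hg _
    rw [hrange]
    exact hgen.mem_of_even hg fun x hx => absurd trivial hx
  · intro i j hij g ⟨hg, hg'⟩
    have k0 : i = 0 → g ∈ closure {b, c, d} := by
      rintro rfl
      refine himage _ _ ?_ hg
      intro i hi
      fin_cases i <;> simp at hi ⊢
    have k1 : i = 1 → g ∈ closure {c, d} := by
      rintro rfl
      refine himage _ _ ?_ hg
      intro i hi
      fin_cases i <;> simp at hi ⊢
    have k2 : i = 2 → g ∈ closure {d} := by
      rintro rfl
      refine himage _ _ ?_ hg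
      intro i hi
      fin_cases i <;> simp at hi ⊢
    have l1 : j = 1 → g ∈ closure {a} := by
      rintro rfl
      refine himage _ _ ?_ hg'
      intro i hi
      fin_cases i <;> simp at hi ⊢
    have l2 : j = 2 → g ∈ closure {a, b} := by
      rintro rfl
      refine himage _ _ ?_ hg'
      intro i hi
      fin_cases i <;> simp at hi ⊢
    have l3 : j = 3 → g ∈ closure {a, b, c} := by
      rintro rfl
      refine himage _ _ ?_ hg'
      intro i hi
      fin_cases i <;> simp at hi ⊢
    fin_cases i <;> fin_cases j <;> simp at hij
    · rcases mem_closure_singleton_of_mul_self ha2 (l1 rfl) with rfl | rfl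
      · exact one_mem _
      · exact absurd (k0 rfl) hI₀
    · refine himage' _ _ ?_ (hI₁ g (k0 rfl) (l2 rfl))
      rintro _ rfl
      exact ⟨1, by simp⟩
    · refine himage' _ _ ?_ (hI g (k0 rfl) (l3 rfl))
      rintro _ (rfl | rfl)
      · exact ⟨1, by simp⟩
      · exact ⟨2, by simp⟩
    · rw [hI₁₂ g (k1 rfl) (l2 rfl)]
      exact one_mem _
    · refine himage' _ _ ?_ (hI₂ g (k1 rfl) (l3 rfl))
      rintro _ rfl
      exact ⟨2, by simp⟩
    · rcases mem_closure_singleton_of_mul_self hd2 (k2 rfl) with rfl | rfl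
      · exact one_mem _
      · exact absurd (l3 rfl) hI₃

end RankFour

theorem maps_of_mem_closure {α : Type*} {S : Set (Perm α)} (p : α → Prop) (hS : ∀ s ∈ S, s * s = 1)
    (h : ∀ s ∈ S, ∀ x, p x → p (s x)) {g : Perm α} (hg : g ∈ closure S) : ∀ x, p x → p (g x) := by
  induction hg using closure_induction_left with
  | one => exact fun _ hx => hx
  | mul_left s hs g _ ih => exact fun x hx => h s hs _ (ih x hx)
  | inv_mul_cancel s hs g _ ih =>
    rw [inv_eq_of_mul_eq_one_left (hS s hs)]
    exact fun x hx => h s hs _ (ih x hx)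

theorem eq_one_or_eq_swap_mul_swap {α : Type*} [Fintype α] [DecidableEq α] {g : Perm α}
    {p q r s : α} (hpq : p ≠ q) (hrs : r ≠ s) (hpr : p ≠ r) (hps : p ≠ s) (hqr : q ≠ r)
    (hqs : q ≠ s) (hg : Perm.sign g = 1)
    (h1 : g p = p ∧ g q = q ∨ g p = q ∧ g q = p) (h2 : g r = r ∧ g s = s ∨ g r = s ∧ g s = r)
    (h : ∀ x, x ≠ p → x ≠ q → x ≠ r → x ≠ s → g x = x) :
    g = 1 ∨ g = swap p q * swap r s := by
  have key (k : Perm α) (hp : g p = k p) (hq : g q = k q) (hr : g r = k r) (hs : g s = k s)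
      (hk : ∀ x, x ≠ p → x ≠ q → x ≠ r → x ≠ s → k x = x) : g = k := by
    ext x
    by_cases hx : x = p ∨ x = q ∨ x = r ∨ x = s
    · rcases hx with rfl | rfl | rfl | rfl <;> assumption
    · simp only [not_or] at hx
      rw [h x hx.1 hx.2.1 hx.2.2.1 hx.2.2.2, hk x hx.1 hx.2.1 hx.2.2.1 hx.2.2.2]
  rcases h1 with ⟨hp, hq⟩ | ⟨hp, hq⟩ <;> rcases h2 with ⟨hr, hs⟩ | ⟨hr, hs⟩
  · exact .inl (key 1 hp hq hr hs fun _ _ _ _ _ => rfl)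
  · have : g = swap r s := by apply key <;> grind
    rw [this, Perm.sign_swap hrs] at hg
    exact absurd hg (by decide)
  · have : g = swap p q := by apply key <;> grind
    rw [this, Perm.sign_swap hpq] at hg
    exact absurd hg (by decide)
  · right
    apply key <;> grind [Perm.mul_apply]

theorem AltOn.insert_of_apply_eq {α : Type*} [DecidableEq α] {H : Subgroup (Perm α)}
    {S : Finset α} (hS : AltOn H (S : Set α)) {x y z w : α} {g : Perm α} (hg : g ∈ H)
    (hgz : g z = w) (hxyz : x ∈ S ∧ y ∈ S ∧ z ∈ S ∧ x ≠ y ∧ x ≠ z ∧ y ≠ z ∧ g x ∈ S ∧ g y ∈ S) :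
    AltOn H (insert w S : Finset α) := by
  obtain ⟨hx, hy, hz, hxy, hxz, hyz, hgx, hgy⟩ := hxyz
  rw [Finset.coe_insert, ← hgz]
  exact altOn_insert_map hS hx hy hz hxy hxz hyz hg hgx hgy

namespace Nine

def a : Perm (Fin 9) := swap 1 2 * swap 3 6 * swap 4 7 * swap 5 8

def b : Perm (Fin 9) := swap 0 1 * swap 2 3

def c : Perm (Fin 9) := swap 3 4 * swap 6 7

def d : Perm (Fin 9) := swap 4 5 * swap 7 8

theorem mul_self : ∀ g ∈ ({a, b, c, d} : Set (Perm (Fin 9))), g * g = 1 := by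
  rintro _ (rfl | rfl | rfl | rfl) <;> decide

theorem sign_eq_one : ∀ g ∈ ({a, b, c, d} : Set (Perm (Fin 9))), Perm.sign g = 1 := by
  rintro _ (rfl | rfl | rfl | rfl) <;> simp [a, b, c, d, Perm.sign_swap']

theorem sign_eq_one_of_mem {g : Perm (Fin 9)} (hg : g ∈ closure {a, b, c, d}) :
    Perm.sign g = 1 :=
  (closure_le Perm.sign.ker).2 sign_eq_one hg

theorem altOn_univ : AltOn (closure {a, b, c, d}) Set.univ := by
  have ha : a ∈ closure {a, b, c, d} := subset_closure (by simp)
  have hb : b ∈ closure {a, b, c, d} := subset_closure (by simp)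
  have hc : c ∈ closure {a, b, c, d} := subset_closure (by simp)
  have hd : d ∈ closure {a, b, c, d} := subset_closure (by simp)
  have h : AltOn (closure {a, b, c, d}) ({2, 3, 4} : Finset (Fin 9)) := by
    refine altOn_of_pair (x := 2) (y := 3) (by decide) ?_
    intro w hw h2 h3
    obtain rfl | rfl | rfl : w = 2 ∨ w = 3 ∨ w = 4 := by simpa using hw
    · exact absurd rfl h2
    · exact absurd rfl h3
    · rw [show cyc 2 3 4 = (b * c) ^ 4 by decide]
      exact pow_mem (mul_mem hb hc) 4
  have h := h.insert_of_apply_eq (x := 2) (y := 3) (z := 4) (w := 5) hd (by decide) (by decide)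
  have h := h.insert_of_apply_eq (x := 3) (y := 4) (z := 2) (w := 0) (mul_mem (mul_mem ha hb) ha)
    (by decide) (by decide)
  have h := h.insert_of_apply_eq (x := 2) (y := 3) (z := 0) (w := 1) hb (by decide) (by decide)
  have h := h.insert_of_apply_eq (x := 1) (y := 2) (z := 3) (w := 6) ha (by decide) (by decide)
  have h := h.insert_of_apply_eq (x := 1) (y := 2) (z := 4) (w := 7) ha (by decide) (by decide)
  have h := h.insert_of_apply_eq (x := 1) (y := 2) (z := 5) (w := 8) ha (by decide) (by decide)
  refine h.mono le_rfl fun x _ => ?_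
  fin_cases x <;> simp

theorem maps_of_mem_bcd {g : Perm (Fin 9)} (hg : g ∈ closure {b, c, d}) :
    (∀ x, x = 0 ∨ x = 1 → g x = 0 ∨ g x = 1) ∧
    (∀ x, x = 2 ∨ x = 3 ∨ x = 4 ∨ x = 5 → g x = 2 ∨ g x = 3 ∨ g x = 4 ∨ g x = 5) ∧
    (∀ x, x = 6 ∨ x = 7 ∨ x = 8 → g x = 6 ∨ g x = 7 ∨ g x = 8) := by
  have h2 : ∀ s ∈ ({b, c, d} : Set (Perm (Fin 9))), s * s = 1 :=
    fun s hs => mul_self s (.inr hs)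
  refine ⟨?_, ?_, ?_⟩
  · refine maps_of_mem_closure (fun x => x = 0 ∨ x = 1) h2 ?_ hg
    rintro _ (rfl | rfl | rfl) <;> decide
  · refine maps_of_mem_closure (fun x => x = 2 ∨ x = 3 ∨ x = 4 ∨ x = 5) h2 ?_ hg
    rintro _ (rfl | rfl | rfl) <;> decide
  · refine maps_of_mem_closure (fun x => x = 6 ∨ x = 7 ∨ x = 8) h2 ?_ hg
    rintro _ (rfl | rfl | rfl) <;> decide

theorem maps_of_mem_abc {g : Perm (Fin 9)} (hg : g ∈ closure {a, b, c}) :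
    (∀ x, x = 5 ∨ x = 8 → g x = 5 ∨ g x = 8) ∧
    (∀ x, x ≠ 5 ∧ x ≠ 8 → g x ≠ 5 ∧ g x ≠ 8) := by
  have h2 : ∀ s ∈ ({a, b, c} : Set (Perm (Fin 9))), s * s = 1 := by
    rintro _ (rfl | rfl | rfl) <;> decide
  refine ⟨?_, ?_⟩
  · refine maps_of_mem_closure (fun x => x = 5 ∨ x = 8) h2 ?_ hg
    rintro _ (rfl | rfl | rfl) <;> decide
  · refine maps_of_mem_closure (fun x => x ≠ 5 ∧ x ≠ 8) h2 ?_ hg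
    rintro _ (rfl | rfl | rfl) <;> decide

theorem mem_bc {g : Perm (Fin 9)} (hg : g ∈ closure {b, c, d}) (hg' : g ∈ closure {a, b, c}) :
    g ∈ closure {b, c} := by
  have hb : b ∈ closure {b, c} := subset_closure (by simp)
  have hc : c ∈ closure {b, c} := subset_closure (by simp)
  have hle : closure {b, c} ≤ closure {b, c, d} := closure_mono (by grind)
  have hle' : closure {b, c} ≤ closure {a, b, c} := closure_mono (by grind)
  have key {h g : Perm (Fin 9)} (h1 : h ∈ closure {b, c}) (h2 : h * g ∈ closure {b, c}) :
      g ∈ closure {b, c} := (mul_mem_cancel_left h1).1 h2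
  have hbc : swap 0 1 * swap 6 7 ∈ closure {b, c} := by
    have := pow_mem (mul_mem hb hc) 3
    rwa [show (b * c) ^ 3 = swap 0 1 * swap 6 7 by decide] at this
  have hfix (g : Perm (Fin 9)) (hg : g ∈ closure {b, c, d}) (hg' : g ∈ closure {a, b, c})
      (h3 : g 3 = 3) (h4 : g 4 = 4) : g ∈ closure {b, c} := by
    have hsign : Perm.sign g = 1 := sign_eq_one_of_mem (closure_mono (by grind) hg)
    obtain ⟨m1, m2, m3⟩ := maps_of_mem_bcd hg
    obtain ⟨m4, m5⟩ := maps_of_mem_abc hg'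
    have := g.injective
    rcases eq_one_or_eq_swap_mul_swap (p := 0) (q := 1) (r := 6) (s := 7) (by decide) (by decide)
      (by decide) (by decide) (by decide) (by decide) hsign (by grind) (by grind) (by
        intro x
        fin_cases x <;> grind) with rfl | rfl
    · exact one_mem _
    · exact hbc
  have hfix' (g : Perm (Fin 9)) (hg : g ∈ closure {b, c, d}) (hg' : g ∈ closure {a, b, c})
      (h4 : g 4 = 4) : g ∈ closure {b, c} := by
    obtain ⟨-, m2, -⟩ := maps_of_mem_bcd hg
    obtain ⟨-, m5⟩ := maps_of_mem_abc hg'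
    have := g.injective
    obtain h3 | h3 : g 3 = 3 ∨ g 3 = 2 := by grind
    · exact hfix g hg hg' h3 h4
    · refine key hb (hfix _ (mul_mem (hle hb) hg) (mul_mem (hle' hb) hg') ?_ ?_) <;>
        simp only [Perm.mul_apply, h3, h4] <;> decide
  obtain ⟨-, m2, -⟩ := maps_of_mem_bcd hg
  obtain ⟨-, m5⟩ := maps_of_mem_abc hg'
  obtain h4 | h4 | h4 : g 4 = 4 ∨ g 4 = 3 ∨ g 4 = 2 := by grind
  · exact hfix' g hg hg' h4
  · refine key hc (hfix' _ (mul_mem (hle hc) hg) (mul_mem (hle' hc) hg') ?_)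
    rw [Perm.mul_apply, h4]
    decide
  · have hcb := mul_mem hc hb
    refine key hcb (hfix' _ (mul_mem (hle hcb) hg) (mul_mem (hle' hcb) hg') ?_)
    rw [Perm.mul_apply, h4]
    decide

theorem mem_b {g : Perm (Fin 9)} (hg : g ∈ closure {b, c, d}) (hg' : g ∈ closure {a, b}) :
    g = 1 ∨ g = b := by
  have hsign : Perm.sign g = 1 := sign_eq_one_of_mem (closure_mono (by grind) hg)
  have h2 : ∀ s ∈ ({a, b} : Set (Perm (Fin 9))), s * s = 1 := by
    rintro _ (rfl | rfl) <;> decide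
  obtain ⟨m1, m2, m3⟩ := maps_of_mem_bcd hg
  have m4 := maps_of_mem_closure (fun x => x = 4 ∨ x = 7) h2
    (by rintro _ (rfl | rfl) <;> decide) hg'
  have m5 := maps_of_mem_closure (fun x => x = 5 ∨ x = 8) h2
    (by rintro _ (rfl | rfl) <;> decide) hg'
  have := g.injective
  have h4 : g 4 = 4 := by grind
  have h5 : g 5 = 5 := by grind
  have h7 : g 7 = 7 := by grind
  have h8 : g 8 = 8 := by grind
  have h6 : g 6 = 6 := by grind
  exact eq_one_or_eq_swap_mul_swap (by decide) (by decide) (by decide) (by decide) (by decide)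
    (by decide) hsign (by grind) (by grind) (by intro x; fin_cases x <;> grind)

theorem exists_isStringCGroupRep :
    ∃ ρ : Fin 4 → alternatingGroup (Fin 9), IsStringCGroupRep ρ := by
  have hle : closure {c, d} ≤ closure {b, c, d} := closure_mono (by grind)
  have hcd {x : Fin 9} (hc : c x = x) (hd : d x = x) {g : Perm (Fin 9)}
      (hg : g ∈ closure {c, d}) : g x = x :=
    fixed_of_mem_closure (by rintro _ (rfl | rfl) <;> assumption) hg
  apply exists_isStringCGroupRep_of_four (a := a) (b := b) (c := c) (d := d) mul_self
  · rintro _ (rfl | rfl | rfl | rfl) <;> decide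
  · exact sign_eq_one
  · unfold Commute SemiconjBy; decide
  · unfold Commute SemiconjBy; decide
  · unfold Commute SemiconjBy; decide
  · exact altOn_univ
  · exact fun h => absurd ((maps_of_mem_bcd h).1 1 (by decide)) (by decide)
  · exact fun h => absurd ((maps_of_mem_abc h).1 5 (by decide)) (by decide)
  · intro g hg hg'
    rcases mem_b hg hg' with rfl | rfl
    exacts [one_mem _, subset_closure rfl]
  · intro g hg hg'
    have hsign : Perm.sign g = 1 := sign_eq_one_of_mem (closure_mono (by grind) hg)
    obtain ⟨m1, m2, m3⟩ := maps_of_mem_bcd (hle hg)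
    obtain ⟨m4, m5⟩ := maps_of_mem_abc hg'
    have h0 : g 0 = 0 := hcd (by decide) (by decide) hg
    have h1 : g 1 = 1 := hcd (by decide) (by decide) hg
    have h2 : g 2 = 2 := hcd (by decide) (by decide) hg
    have := g.injective
    have h5 : g 5 = 5 := by grind
    have h8 : g 8 = 8 := by grind
    rcases eq_one_or_eq_swap_mul_swap (p := 3) (q := 4) (r := 6) (s := 7) (by decide) (by decide)
      (by decide) (by decide) (by decide) (by decide) hsign (by grind) (by grind) (by
        intro x
        fin_cases x <;> grind) with rfl | rfl
    exacts [one_mem _, subset_closure rfl]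
  · intro g hg hg'
    rcases mem_b (hle hg) hg' with rfl | rfl
    · rfl
    · exact absurd (hcd (x := 0) (by decide) (by decide) hg) (by decide)
  · exact fun g hg hg' => mem_bc hg hg'

end Nine

namespace Ten

def a : Perm (Fin 10) := swap 0 1 * swap 2 3

def b : Perm (Fin 10) := swap 1 2 * swap 3 4

def c : Perm (Fin 10) := swap 2 3 * swap 4 6 * swap 5 7 * swap 8 9

def d : Perm (Fin 10) := swap 6 8 * swap 7 9

theorem mul_self : ∀ g ∈ ({a, b, c, d} : Set (Perm (Fin 10))), g * g = 1 := by
  rintro _ (rfl | rfl | rfl | rfl) <;> decide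

set_option maxRecDepth 10000 in
theorem altOn_univ : AltOn (closure {a, b, c, d}) Set.univ := by
  have ha : a ∈ closure {a, b, c, d} := subset_closure (by simp)
  have hb : b ∈ closure {a, b, c, d} := subset_closure (by simp)
  have hc : c ∈ closure {a, b, c, d} := subset_closure (by simp)
  have hd : d ∈ closure {a, b, c, d} := subset_closure (by simp)
  have h : AltOn (closure {a, b, c, d}) ({0, 1, 2} : Finset (Fin 10)) := by
    refine altOn_of_pair (x := 0) (y := 2) (by decide) ?_
    intro w hw h2 h3
    obtain rfl | rfl | rfl : w = 0 ∨ w = 1 ∨ w = 2 := by simpa using hw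
    · exact absurd rfl h2
    · rw [show cyc 0 2 1 = (b * a * c * d) ^ 7 by decide]
      exact pow_mem (mul_mem (mul_mem (mul_mem hb ha) hc) hd) 7
    · exact absurd rfl h3
  have h := h.insert_of_apply_eq (x := 0) (y := 1) (z := 2) (w := 3) ha (by decide) (by decide)
  have h := h.insert_of_apply_eq (x := 0) (y := 1) (z := 3) (w := 4) hb (by decide) (by decide)
  have h := h.insert_of_apply_eq (x := 0) (y := 1) (z := 4) (w := 6) hc (by decide) (by decide)
  have h := h.insert_of_apply_eq (x := 0) (y := 1) (z := 6) (w := 8) hd (by decide) (by decide)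
  have h := h.insert_of_apply_eq (x := 0) (y := 1) (z := 8) (w := 9) hc (by decide) (by decide)
  have h := h.insert_of_apply_eq (x := 0) (y := 1) (z := 9) (w := 7) hd (by decide) (by decide)
  have h := h.insert_of_apply_eq (x := 0) (y := 1) (z := 7) (w := 5) hc (by decide) (by decide)
  refine h.mono le_rfl fun x _ => ?_
  fin_cases x <;> simp

set_option maxRecDepth 10000 in
theorem mem_closure_d_of_apply_five {g : Perm (Fin 10)} (hg : g ∈ closure {c, d}) (h5 : g 5 = 5) :
    g ∈ closure {d} := by
  have hd : ∀ k : Perm (Fin 10), k = 1 ∨ k = d → k ∈ closure {d} := by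
    rintro _ (rfl | rfl)
    exacts [one_mem _, subset_closure rfl]
  refine mem_of_coset_representatives (x := 5) (S := {c, d})
    ![1, c, d * c, c * d * c, d * c * d * c, c * d * c * d * c] (i₀ := 0) rfl ?_ ?_ ?_ ?_ hg h5
  · rintro _ (rfl | rfl) <;> decide
  · rintro _ (rfl | rfl) i
    · obtain ⟨j, hj⟩ : ∃ j, j = ![(1 : Fin 6), 0, 3, 2, 5, 4] i := ⟨_, rfl⟩
      refine ⟨j, hd _ ?_⟩
      subst hj
      revert i
      decide
    · obtain ⟨j, hj⟩ : ∃ j, j = ![(0 : Fin 6), 2, 1, 4, 3, 5] i := ⟨_, rfl⟩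
      refine ⟨j, hd _ ?_⟩
      subst hj
      revert i
      decide
  · exact fun h hh => fixed_of_mem_closure (by rintro _ rfl; decide) hh
  · decide

theorem mem_closure_b {g : Perm (Fin 10)} (hg : g ∈ closure {b, c, d}) (hg' : g ∈ closure {a, b}) :
    g ∈ closure {b} := by
  have h0 : g 0 = 0 := fixed_of_mem_closure (by rintro _ (rfl | rfl | rfl) <;> decide) hg
  apply mem_closure_of_fixed_of_pow_five (a := a) (x := 0) _ _ _ _ _ _ _ _ hg' h0 <;> decide

set_option maxRecDepth 10000 in
theorem mem_closure_bc {g : Perm (Fin 10)} (hg : g ∈ closure {b, c, d})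
    (hg' : g ∈ closure {a, b, c}) : g ∈ closure {b, c} := by
  have h0 : g 0 = 0 := fixed_of_mem_closure (by rintro _ (rfl | rfl | rfl) <;> decide) hg
  apply mem_closure_pair_of_fixed (a := a) (x := 0) _ _ _ _ _ _ _ _ _ _ _ _ _ _ hg' h0 <;> decide

theorem exists_isStringCGroupRep :
    ∃ ρ : Fin 4 → alternatingGroup (Fin 10), IsStringCGroupRep ρ := by
  have hle : closure {c, d} ≤ closure {b, c, d} := closure_mono (by grind)
  have h2 : ∀ s ∈ ({a, b, c} : Set (Perm (Fin 10))), s * s = 1 :=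
    fun s hs => mul_self s (by grind)
  have m1 {g : Perm (Fin 10)} (hg : g ∈ closure {a, b, c}) :=
    maps_of_mem_closure (fun x => x = 5 ∨ x = 7) h2
      (by rintro _ (rfl | rfl | rfl) <;> decide) hg
  have m2 {g : Perm (Fin 10)} (hg : g ∈ closure {a, b, c}) :=
    maps_of_mem_closure (fun x => x = 8 ∨ x = 9) h2
      (by rintro _ (rfl | rfl | rfl) <;> decide) hg
  have hd {g : Perm (Fin 10)} (hg : g ∈ closure {c, d}) (hg' : g ∈ closure {a, b, c})
      (h5 : g 5 = 5) : g = 1 := by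
    rcases mem_closure_singleton_of_mul_self (by decide) (mem_closure_d_of_apply_five hg h5)
      with rfl | rfl
    · rfl
    · exact absurd (m2 hg' 8 (by decide)) (by decide)
  apply exists_isStringCGroupRep_of_four (a := a) (b := b) (c := c) (d := d) mul_self
  · rintro _ (rfl | rfl | rfl | rfl) <;> decide
  · rintro _ (rfl | rfl | rfl | rfl) <;> simp [a, b, c, d, Perm.sign_swap']
  · unfold Commute SemiconjBy; decide
  · unfold Commute SemiconjBy; decide
  · unfold Commute SemiconjBy; decide
  · exact altOn_univ
  · exact fun h => absurd (fixed_of_mem_closure (x := 0)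
      (by rintro _ (rfl | rfl | rfl) <;> decide) h) (by decide)
  · exact fun h => absurd (m2 h 8 (by decide)) (by decide)
  · exact fun g hg hg' => mem_closure_b hg hg'
  · intro g hg hg'
    rcases m1 hg' 5 (by decide) with h5 | h5
    · rw [hd hg hg' h5]
      exact one_mem _
    · have h := hd (g := c * g) (mul_mem (subset_closure (by simp)) hg)
        (mul_mem (subset_closure (by simp)) hg') (by rw [Perm.mul_apply, h5]; decide)
      rw [eq_inv_of_mul_eq_one_right h]
      exact inv_mem (subset_closure rfl)
  · intro g hg hg'
    rcases mem_closure_singleton_of_mul_self (by decide) (mem_closure_b (hle hg) hg')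
      with rfl | rfl
    · rfl
    · exact absurd (fixed_of_mem_closure (x := 1)
        (by rintro _ (rfl | rfl) <;> decide) hg) (by decide)
  · exact fun g hg hg' => mem_closure_bc hg hg'

end Ten

/-- For every `n ≥ 9` with `n ≠ 11`, the alternating group `A_n` has a string
C-group representation of rank `⌊(n-1)/2⌋`. -/
theorem alternatingGroup_exists_max_rank (n : ℕ) (hn : 9 ≤ n) (hn11 : n ≠ 11) :
    ∃ ρ : Fin ((n - 1) / 2) → alternatingGroup (Fin n), IsStringCGroupRep ρ := by
  obtain rfl | rfl | h : n = 9 ∨ n = 10 ∨ 12 ≤ n := by omega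
  · exact Nine.exists_isStringCGroupRep
  · exact Ten.exists_isStringCGroupRep
  · exact exists_isStringCGroupRep_of_twelve_le h
end

section
/- Let F be a finite field. Every string C-group representation of the projective special linear group PSL(2,F) has rank at most 4. -/
open Matrix

namespace IsStringCGroupRep

variable {G : Type*} [Group G] {n : ℕ} {ρ : Fin n → G}

/-- The generators are independent. -/
theorem notMem_closure (h : IsStringCGroupRep ρ) {j : Fin n} {I : Set (Fin n)} (hj : j ∉ I) :
    ρ j ∉ Subgroup.closure (ρ '' I) := by
  intro hmem
  have hbot : ρ j ∈ Subgroup.closure (ρ '' I) ⊓ Subgroup.closure (ρ '' {j}) :=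
    ⟨hmem, Subgroup.subset_closure ⟨j, rfl, rfl⟩⟩
  rw [h.2.2.2, Set.inter_singleton_eq_empty.2 hj, Set.image_empty, Subgroup.closure_empty,
    Subgroup.mem_bot] at hbot
  simpa [hbot] using h.1 j

theorem injective (h : IsStringCGroupRep ρ) : Function.Injective ρ := by
  intro i j hij
  by_contra hne
  exact h.notMem_closure (j := i) (I := {j}) hne
    (hij ▸ Subgroup.subset_closure ⟨j, rfl, rfl⟩)

/-- If commuting is transitive on involutions, a string C-group representation of rank at least
five generates a commutative group. -/
theorem commute_of_commute_trans (h : IsStringCGroupRep ρ) (hn : 5 ≤ n)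
    (htrans : ∀ a b c : G, orderOf a = 2 → orderOf b = 2 → orderOf c = 2 →
      Commute a b → Commute b c → Commute a c) (x y : G) : Commute x y := by
  have hfar : ∀ i j : Fin n, i.val + 1 < j.val ∨ j.val + 1 < i.val → Commute (ρ i) (ρ j) := by
    rintro i j (hij | hij)
    · exact h.2.2.1 i j hij
    · exact (h.2.2.1 j i hij).symm
  have hpath : ∀ i j : Fin n, i.val < j.val → Commute (ρ i) (ρ j) := by
    intro i j hij
    by_cases hlt : i.val + 1 < j.val
    · exact h.2.2.1 i j hlt
    obtain ⟨k, hik, hkj⟩ : ∃ k : Fin n, (i.val + 1 < k.val ∨ k.val + 1 < i.val) ∧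
        (k.val + 1 < j.val ∨ j.val + 1 < k.val) := by
      by_cases hi : 2 ≤ i.val
      · exact ⟨⟨0, by omega⟩, by simp only []; omega, by simp only []; omega⟩
      · exact ⟨⟨i.val + 3, by omega⟩, by simp only []; omega, by simp only []; omega⟩
    exact htrans _ _ _ (h.1 i) (h.1 k) (h.1 j) (hfar i k hik) (hfar k j hkj)
  have hcomm : ∀ a ∈ Set.range ρ, ∀ b ∈ Set.range ρ, a * b = b * a := by
    rintro _ ⟨i, rfl⟩ _ ⟨j, rfl⟩
    rcases lt_trichotomy i j with hij | rfl | hij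
    · exact hpath i j hij
    · rfl
    · exact (hpath j i hij).symm
  have hx : x ∈ Subgroup.closure (Set.range ρ) := h.2.1 ▸ Subgroup.mem_top x
  have hy : y ∈ Subgroup.closure (Set.range ρ) := h.2.1 ▸ Subgroup.mem_top y
  induction hx, hy using Subgroup.closure_induction₂ with
  | mem a b ha hb => exact hcomm a ha b hb
  | one_left => exact Commute.one_left _
  | one_right => exact Commute.one_right _
  | mul_left _ _ _ _ _ _ h₁ h₂ => exact h₁.mul_left h₂
  | mul_right _ _ _ _ _ _ h₁ h₂ => exact h₁.mul_right h₂
  | inv_left _ _ _ _ h₁ => exact h₁.inv_left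
  | inv_right _ _ _ _ h₁ => exact h₁.inv_right

end IsStringCGroupRep

namespace Matrix.ProjectiveSpecialLinearGroup

variable {F : Type*} [Field F]

local notation "SL₂" => SpecialLinearGroup (Fin 2) F
local notation "PSL₂" => ProjectiveSpecialLinearGroup (Fin 2) F

theorem mem_center_fin_two {g : SL₂} :
    g ∈ Subgroup.center SL₂ ↔ g = 1 ∨ g = -1 := by
  rw [SpecialLinearGroup.mem_center_iff]
  constructor
  · rintro ⟨r, hr, hg⟩
    rw [Fintype.card_fin, sq_eq_one_iff] at hr
    rcases hr with rfl | rfl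
    · left; ext i j; simp [← hg]
    · right; ext i j; fin_cases i <;> fin_cases j <;> simp [← hg]
  · rintro (rfl | rfl)
    · exact ⟨1, by simp, by simp⟩
    · exact ⟨-1, by simp, by ext i j; fin_cases i <;> fin_cases j <;> simp⟩

theorem mk_eq_mk_iff {g h : SL₂} : (QuotientGroup.mk g : PSL₂) = QuotientGroup.mk h ↔
    h = g ∨ h = -g := by
  rw [QuotientGroup.eq, mem_center_fin_two, inv_mul_eq_one, inv_mul_eq_iff_eq_mul, mul_neg_one,
    eq_comm]

theorem commute_mk_iff {g h : SL₂} :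
    Commute (QuotientGroup.mk g : PSL₂) (QuotientGroup.mk h) ↔
      h * g = g * h ∨ h * g = -(g * h) := by
  rw [commute_iff_eq, ← QuotientGroup.mk_mul, ← QuotientGroup.mk_mul, mk_eq_mk_iff]

/-- Involutions lift to trace zero matrices. -/
theorem apply_one_one_of_orderOf_mk {g : SL₂} (hg : orderOf (QuotientGroup.mk g : PSL₂) = 2) :
    g 1 1 = -g 0 0 := by
  have hsq : (QuotientGroup.mk 1 : PSL₂) = QuotientGroup.mk (g * g) := by
    rw [QuotientGroup.mk_mul, ← sq, orderOf_dvd_iff_pow_eq_one.1 hg.dvd, QuotientGroup.mk_one]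
  have hne : (QuotientGroup.mk 1 : PSL₂) ≠ QuotientGroup.mk g := by
    intro heq
    rw [← heq, QuotientGroup.mk_one, orderOf_one] at hg
    omega
  rw [mk_eq_mk_iff] at hsq
  contrapose! hne
  have ht : g 0 0 + g 1 1 ≠ 0 := fun h0 => hne (by linear_combination h0)
  have hdet := g.det_coe
  rw [det_fin_two] at hdet
  have hentry : ∀ i j, i ≠ j → (g * g) i j = 0 ∧ (g * g) 0 0 = (g * g) 1 1 := by
    intro i j hij
    rcases hsq with h | h <;> simp [h, hij]
  have h01 := (hentry 0 1 (by decide)).1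
  obtain ⟨h10, hd⟩ := hentry 1 0 (by decide)
  simp only [SpecialLinearGroup.coe_mul, Matrix.mul_apply, Fin.sum_univ_two] at h01 h10 hd
  have hb : g 0 1 = 0 := (mul_eq_zero.1 (by linear_combination h01 :
    (g 0 0 + g 1 1) * g 0 1 = 0)).resolve_left ht
  have hc : g 1 0 = 0 := (mul_eq_zero.1 (by linear_combination h10 :
    (g 0 0 + g 1 1) * g 1 0 = 0)).resolve_left ht
  have had : g 0 0 = g 1 1 := sub_eq_zero.1 ((mul_eq_zero.1 (by linear_combination hd :
    (g 0 0 + g 1 1) * (g 0 0 - g 1 1) = 0)).resolve_left ht)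
  rw [hb, ← had, zero_mul, sub_zero, ← sq, sq_eq_one_iff] at hdet
  rw [mk_eq_mk_iff]
  rcases hdet with h | h
  · left; ext i j; fin_cases i <;> fin_cases j <;> simp [h, hb, hc, ← had]
  · right; ext i j; fin_cases i <;> fin_cases j <;> simp [h, hb, hc, ← had]

/-- In odd characteristic, commuting trace zero elements agree up to sign. -/
theorem mk_eq_mk_of_mul_eq_mul (h2 : (2 : F) ≠ 0) {g h : SL₂} (hg : g 1 1 = -g 0 0)
    (hh : h 1 1 = -h 0 0) (hgh : h * g = g * h) :
    (QuotientGroup.mk g : PSL₂) = QuotientGroup.mk h := by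
  have hdg := g.det_coe
  have hdh := h.det_coe
  rw [det_fin_two] at hdg hdh
  have h00 := congrArg (fun x : SL₂ => x 0 0) hgh
  have h01 := congrArg (fun x : SL₂ => x 0 1) hgh
  have h10 := congrArg (fun x : SL₂ => x 1 0) hgh
  simp only [SpecialLinearGroup.coe_mul, Matrix.mul_apply, Fin.sum_univ_two] at h00 h01 h10
  rw [hg] at hdg h01 h10
  rw [hh] at hdh h01 h10
  have e01 : g 0 0 * h 0 1 = h 0 0 * g 0 1 := mul_left_cancel₀ h2 (by linear_combination -h01)
  have e10 : g 0 0 * h 1 0 = h 0 0 * g 1 0 := mul_left_cancel₀ h2 (by linear_combination h10)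
  obtain ⟨x, hx⟩ : ∃ x, x = -(g 0 0 * h 0 0 + g 0 1 * h 1 0) := ⟨_, rfl⟩
  have f00 : h 0 0 = x * g 0 0 := by
    rw [hx]; linear_combination (-h 0 0) * hdg + g 0 1 * e10
  have f01 : h 0 1 = x * g 0 1 := by
    rw [hx]; linear_combination (-h 0 1) * hdg - g 0 0 * e01 - g 0 1 * h00
  have f10 : h 1 0 = x * g 1 0 := by
    rw [hx]; linear_combination (-h 1 0) * hdg - g 0 0 * e10
  have hx1 : x ^ 2 = 1 := by
    rw [f00, f01, f10] at hdh
    linear_combination hdh - x ^ 2 * hdg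
  rw [mk_eq_mk_iff]
  rcases sq_eq_one_iff.1 hx1 with rfl | rfl
  · left; ext i j; fin_cases i <;> fin_cases j <;> simp [f00, f01, f10, hg, hh]
  · right; ext i j; fin_cases i <;> fin_cases j <;> simp [f00, f01, f10, hg, hh]

/-- In odd characteristic, three distinct commuting involutions form a Klein four-group together
with the identity. -/
theorem eq_mul_of_commute (h2 : (2 : F) ≠ 0) {a b c : PSL₂} (ha : orderOf a = 2)
    (hb : orderOf b = 2) (hc : orderOf c = 2) (hab : Commute a b) (hac : Commute a c)
    (hbc : Commute b c) (nab : a ≠ b) (nac : a ≠ c) (nbc : b ≠ c) : a * b = c := by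
  induction a using QuotientGroup.induction_on with | H a => ?_
  induction b using QuotientGroup.induction_on with | H b => ?_
  induction c using QuotientGroup.induction_on with | H c => ?_
  replace ha := apply_one_one_of_orderOf_mk ha
  replace hb := apply_one_one_of_orderOf_mk hb
  replace hc := apply_one_one_of_orderOf_mk hc
  have hab' := (commute_mk_iff.1 hab).resolve_left
    fun h => nab (mk_eq_mk_of_mul_eq_mul h2 ha hb h)
  have hac' := (commute_mk_iff.1 hac).resolve_left
    fun h => nac (mk_eq_mk_of_mul_eq_mul h2 ha hc h)
  have hbc' := (commute_mk_iff.1 hbc).resolve_left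
    fun h => nbc (mk_eq_mk_of_mul_eq_mul h2 hb hc h)
  rw [← QuotientGroup.mk_mul]
  refine mk_eq_mk_of_mul_eq_mul h2 ?_ hc ?_
  · have h00 := congrArg (fun x : SL₂ => x 0 0) hab'
    simp only [SpecialLinearGroup.coe_neg, Matrix.neg_apply, SpecialLinearGroup.coe_mul,
      Matrix.mul_apply, Fin.sum_univ_two] at h00 ⊢
    rw [ha, hb]
    linear_combination h00
  · rw [← mul_assoc, hac', neg_mul, mul_assoc, hbc', mul_neg, neg_neg, mul_assoc]

/-- In characteristic two, commuting is transitive on involutions. -/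
theorem commute_trans (h2 : (2 : F) = 0) {a b c : PSL₂} (ha : orderOf a = 2)
    (hb : orderOf b = 2) (hc : orderOf c = 2) (hab : Commute a b) (hbc : Commute b c) :
    Commute a c := by
  induction a using QuotientGroup.induction_on with | H a => ?_
  induction b using QuotientGroup.induction_on with | H b => ?_
  induction c using QuotientGroup.induction_on with | H c => ?_
  replace ha := apply_one_one_of_orderOf_mk ha
  have hb' := apply_one_one_of_orderOf_mk hb
  replace hc := apply_one_one_of_orderOf_mk hc
  have hneg : ∀ x : F, -x = x := fun x => by linear_combination -x * h2
  have hnegSL : ∀ g : SL₂, -g = g := fun g => by ext i j; simp [hneg]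
  rw [commute_mk_iff, hnegSL, or_self] at hab hbc ⊢
  rw [hneg] at ha hb' hc
  have hab' := congrArg (fun x : SL₂ => x 0 0) hab
  have hbc' := congrArg (fun x : SL₂ => x 0 0) hbc
  simp only [SpecialLinearGroup.coe_mul, Matrix.mul_apply, Fin.sum_univ_two] at hab' hbc'
  have hbne : b 0 1 ≠ 0 ∨ b 1 0 ≠ 0 := by
    by_contra! hzero
    have hdet := b.det_coe
    rw [det_fin_two, hzero.1, hb', zero_mul, sub_zero, ← sq, sq_eq_one_iff, hneg, or_self] at hdet
    have hb1 : b = 1 := by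
      ext i j; fin_cases i <;> fin_cases j <;> simp [hzero, hb', hdet]
    rw [hb1, QuotientGroup.mk_one, orderOf_one] at hb
    omega
  have key : c 0 1 * a 1 0 = a 0 1 * c 1 0 := by
    rcases hbne with h | h
    · exact mul_left_cancel₀ h (by linear_combination c 0 1 * hab' + a 0 1 * hbc')
    · exact mul_left_cancel₀ h (by linear_combination a 1 0 * hbc' + c 1 0 * hab')
  ext i j
  fin_cases i <;> fin_cases j <;>
    simp only [SpecialLinearGroup.coe_mul, Matrix.mul_apply, Fin.sum_univ_two, Fin.zero_eta,
      Fin.mk_one, ha, hc]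
  · linear_combination key
  · ring
  · ring
  · linear_combination -key

theorem exists_not_commute : ∃ a b : PSL₂, ¬ Commute a b := by
  let g : SL₂ := ⟨!![1, 1; 0, 1], by simp⟩
  let h : SL₂ := ⟨!![1, 0; 1, 1], by simp⟩
  refine ⟨QuotientGroup.mk g, QuotientGroup.mk h, fun hgh => ?_⟩
  rw [commute_mk_iff] at hgh
  rcases hgh with e | e
  · have h00 := congrArg (fun x : SL₂ => x 0 0) e
    simp only [SpecialLinearGroup.coe_mul, Matrix.mul_apply, Fin.sum_univ_two] at h00
    simp [g, h] at h00
  · have h00 := congrArg (fun x : SL₂ => x 0 0) e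
    have h01 := congrArg (fun x : SL₂ => x 0 1) e
    simp only [SpecialLinearGroup.coe_neg, Matrix.neg_apply, SpecialLinearGroup.coe_mul,
      Matrix.mul_apply, Fin.sum_univ_two] at h00 h01
    simp [g, h] at h00 h01
    exact one_ne_zero (α := F) (by linear_combination h00 - h01)

end Matrix.ProjectiveSpecialLinearGroup

open Matrix.ProjectiveSpecialLinearGroup in
/-- Every string C-group representation of `PSL(2, F)`, `F` a finite field, has
rank at most four. -/
theorem psl2_stringCRank_le_four (F : Type*) [Field F] [Fintype F]
    (n : ℕ) (ρ : Fin n → Matrix.ProjectiveSpecialLinearGroup (Fin 2) F)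
    (h : IsStringCGroupRep ρ) : n ≤ 4 := by
  by_contra! hn
  by_cases h2 : (2 : F) = 0
  · obtain ⟨a, b, hab⟩ := exists_not_commute (F := F)
    exact hab (h.commute_of_commute_trans hn
      (fun _ _ _ ha hb hc => commute_trans h2 ha hb hc) a b)
  · let i : Fin n := ⟨0, by omega⟩
    let j : Fin n := ⟨2, by omega⟩
    let k : Fin n := ⟨4, by omega⟩
    have hij : i ≠ j := by simp [i, j]
    have hik : i ≠ k := by simp [i, k]
    have hjk : j ≠ k := by simp [j, k]
    have hmul := eq_mul_of_commute h2 (h.1 i) (h.1 j) (h.1 k)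
      (h.2.2.1 i j (by simp [i, j])) (h.2.2.1 i k (by simp [i, k]))
      (h.2.2.1 j k (by simp [j, k])) (h.injective.ne hij) (h.injective.ne hik)
      (h.injective.ne hjk)
    refine h.notMem_closure (j := k) (I := {i, j}) (by simp [hik.symm, hjk.symm]) ?_
    rw [← hmul]
    exact mul_mem (Subgroup.subset_closure ⟨i, by simp, rfl⟩)
      (Subgroup.subset_closure ⟨j, by simp, rfl⟩)
end
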